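/- arXiv:1404.2379 — 8 statements merged into one kernel-verified Lean document; each statement's English description precedes it below -/
import Mathlib

section
/- For every k ∈ ℂ there exists a unique continuous function f : [0,∞) → ℂ satisfying the Jost integral equation f(x) = e^{ikx} + ∫_x^b s_k(y−x) V(y) f(y) dy for 0 ≤ x ≤ b and f(x) = e^{ikx} for x ≥ b. -/
open MeasureTheory Set Filter

/-- The kernel `s_k(t) = sin(kt)/k` for `k ≠ 0`, and `s_0(t) = t`. -/
noncomputable def jostKernel (k : ℂ) (t : ℝ) : ℂ :=
  if k = 0 then (t : ℂ) else Complex.sin (k * t) / k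

/-- A class-A potential: measurable, integrable on `(0,b)`, vanishing outside `(0,b)`. -/
def ClassA (b : ℝ) (V : ℝ → ℝ) : Prop :=
  Measurable V ∧ IntegrableOn V (Set.Ioo 0 b) ∧ ∀ x, x ∉ Set.Ioo 0 b → V x = 0

/-- `f` is a (continuous) solution of the Jost integral equation at parameter `k`. -/
def IsJostSolution (b : ℝ) (V : ℝ → ℝ) (k : ℂ) (f : ℝ → ℂ) : Prop :=
  ContinuousOn f (Set.Ici 0) ∧
  (∀ x : ℝ, 0 ≤ x → x ≤ b →
      f x = Complex.exp (Complex.I * k * x)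
        + ∫ y in x..b, jostKernel k (y - x) * (V y : ℂ) * f y) ∧
  ∀ x : ℝ, b ≤ x → f x = Complex.exp (Complex.I * k * x)

lemma continuous_jostKernel (k : ℂ) : Continuous (jostKernel k) := by
  unfold jostKernel
  by_cases hk : k = 0
  · simpa [hk] using Complex.continuous_ofReal
  · simp only [hk, if_false]
    fun_prop

lemma jostKernel_zero (k : ℂ) : jostKernel k 0 = 0 := by
  simp [jostKernel]

lemma ClassA.integrable {b : ℝ} {V : ℝ → ℝ} (hV : ClassA b V) : Integrable V :=
  (integrableOn_iff_integrable_of_support_subset fun x hx => by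
    by_contra h
    exact hx (hV.2.2 x h)).1 hV.2.1

/-- Exponentially damped tails of an integrable function are uniformly small for strong damping. -/
lemma MeasureTheory.Integrable.exists_integral_exp_decay_le {V : ℝ → ℝ} (hV : Integrable V)
    {ε : ℝ} (hε : 0 < ε) :
    ∃ c : ℝ, 0 < c ∧ ∀ x, ∫ y in Ioi x, |V y| * Real.exp (-c * (y - x)) ≤ ε := by
  obtain ⟨g, hgs, hg, hgc, hgi⟩ := hV.exists_hasCompactSupport_integral_sub_le (half_pos hε)
  obtain ⟨M, hM⟩ := hgs.exists_bound_of_continuous hgc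
  have hM0 : 0 ≤ M := (norm_nonneg _).trans (hM 0)
  have hc : 0 < 2 * (M + 1) / ε := by positivity
  refine ⟨2 * (M + 1) / ε, hc, fun x => ?_⟩
  set c := 2 * (M + 1) / ε
  have hexp (y : ℝ) : Real.exp (-c * (y - x)) = Real.exp (c * x) * Real.exp (-c * y) := by
    rw [← Real.exp_add]; ring_nf
  have hei : IntegrableOn (fun y => M * Real.exp (-c * (y - x))) (Ioi x) := by
    simp only [hexp]
    exact ((integrableOn_exp_mul_Ioi (neg_lt_zero.2 hc) x).const_mul _).const_mul _
  have hev : ∫ y in Ioi x, M * Real.exp (-c * (y - x)) = M / c := by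
    simp only [hexp]
    rw [integral_const_mul, integral_const_mul, integral_exp_mul_Ioi (neg_lt_zero.2 hc),
      neg_div_neg_eq, ← mul_div_assoc, ← Real.exp_add]
    simp [div_eq_mul_inv]
  have hdi : IntegrableOn (fun y => ‖V y - g y‖) (Ioi x) := (hV.sub hgi).norm.integrableOn
  calc ∫ y in Ioi x, |V y| * Real.exp (-c * (y - x))
      ≤ ∫ y in Ioi x, (‖V y - g y‖ + M * Real.exp (-c * (y - x))) := by
        refine integral_mono_of_nonneg (.of_forall fun y => by positivity) (hdi.add hei) ?_
        filter_upwards [ae_restrict_mem measurableSet_Ioi] with y hy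
        have h1 : Real.exp (-c * (y - x)) ≤ 1 := by
          rw [Real.exp_le_one_iff]
          nlinarith [mem_Ioi.1 hy]
        have h2 : |V y| ≤ ‖V y - g y‖ + M := by
          have := norm_add_le (V y - g y) (g y)
          rw [sub_add_cancel] at this
          exact this.trans (by gcongr; exact hM y)
        calc |V y| * Real.exp (-c * (y - x))
            ≤ (‖V y - g y‖ + M) * Real.exp (-c * (y - x)) := by gcongr
          _ ≤ ‖V y - g y‖ + M * Real.exp (-c * (y - x)) := by
            nlinarith [norm_nonneg (V y - g y)]
    _ = (∫ y in Ioi x, ‖V y - g y‖) + M / c := by rw [integral_add hdi hei, hev]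
    _ ≤ ε / 2 + ε / 2 := by
        refine add_le_add ?_ ?_
        · exact (setIntegral_le_integral (hV.sub hgi).norm
            (.of_forall fun y => norm_nonneg _)).trans hg
        · rw [div_le_iff₀ hc]
          have : ε / 2 * c = M + 1 := by simp only [c]; field_simp
          linarith
    _ = ε := add_halves ε

/-- The damped Jost kernel, extended by zero to negative arguments. -/
noncomputable def dampedKernel (k : ℂ) (c t : ℝ) : ℂ :=
  jostKernel k (max t 0) * Complex.exp (-c * t)

lemma continuous_dampedKernel (k : ℂ) (c : ℝ) : Continuous (dampedKernel k c) := by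
  unfold dampedKernel
  have := continuous_jostKernel k
  fun_prop

lemma dampedKernel_of_nonpos (k : ℂ) (c : ℝ) {t : ℝ} (ht : t ≤ 0) : dampedKernel k c t = 0 := by
  simp [dampedKernel, max_eq_right ht, jostKernel_zero]

lemma norm_dampedKernel_le {k : ℂ} {c b C t : ℝ} (hC : ∀ t ∈ Icc 0 b, ‖jostKernel k t‖ ≤ C)
    (ht0 : 0 ≤ t) (htb : t ≤ b) : ‖dampedKernel k c t‖ ≤ C * Real.exp (-c * t) := by
  rw [dampedKernel, max_eq_left ht0, norm_mul, Complex.norm_exp]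
  have : (-(c : ℂ) * t).re = -c * t := by simp
  rw [this]
  gcongr
  exact hC t ⟨ht0, htb⟩

/-- The integral in the Jost equation, written with the damped kernel over the whole line. -/
lemma exp_mul_integral_jostKernel {b : ℝ} {V : ℝ → ℝ} (hV : ClassA b V) (k : ℂ) (c : ℝ)
    (F : ℝ → ℂ) {x : ℝ} (hxb : x ≤ b) :
    Complex.exp (c * x) * ∫ y in x..b, jostKernel k (y - x) * (V y : ℂ) * F y
      = ∫ y, dampedKernel k c (y - x) * (V y : ℂ) * (Complex.exp (c * y) * F y) := by
  rw [intervalIntegral.integral_of_le hxb, ← integral_indicator measurableSet_Ioc,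
    ← integral_const_mul]
  congr 1 with y
  by_cases hy : y ∈ Ioc x b
  · have : Complex.exp (c * x) = Complex.exp (-c * (y - x)) * Complex.exp (c * y) := by
      rw [← Complex.exp_add]; ring_nf
    rw [indicator_of_mem hy, dampedKernel, max_eq_left (sub_nonneg.2 hy.1.le), this]
    push_cast
    ring
  · rw [indicator_of_notMem hy, mul_zero]
    by_cases hyx : y ≤ x
    · simp [dampedKernel_of_nonpos k c (sub_nonpos.2 hyx)]
    · have : V y = 0 := hV.2.2 y fun h => hy ⟨not_le.1 hyx, h.2.le⟩
      simp [this]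

lemma norm_dampedKernel_mul_le {b : ℝ} {V : ℝ → ℝ} (hV : ClassA b V) {k : ℂ} {c C : ℝ}
    (hC : ∀ t ∈ Icc 0 b, ‖jostKernel k t‖ ≤ C) {x : ℝ} (hx : 0 ≤ x) (y : ℝ) :
    ‖dampedKernel k c (y - x) * (V y : ℂ)‖
      ≤ (Ioi x).indicator (fun y => C * (|V y| * Real.exp (-c * (y - x)))) y := by
  by_cases hyx : y ≤ x
  · simp [dampedKernel_of_nonpos k c (sub_nonpos.2 hyx), hyx]
  rw [indicator_of_mem (mem_Ioi.2 (not_le.1 hyx))]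
  by_cases hy : y ∈ Ioo 0 b
  · rw [norm_mul, Complex.norm_real, Real.norm_eq_abs]
    calc _ ≤ C * Real.exp (-c * (y - x)) * |V y| := by
          gcongr
          exact norm_dampedKernel_le hC (by linarith) (by linarith [hy.2])
      _ = _ := by ring
  · simp [hV.2.2 y hy]

lemma norm_dampedKernel_mul_le_const_mul {b : ℝ} {V : ℝ → ℝ} (hV : ClassA b V) {k : ℂ} {c C : ℝ}
    (hc : 0 < c) (hC0 : 0 ≤ C) (hC : ∀ t ∈ Icc 0 b, ‖jostKernel k t‖ ≤ C) {x : ℝ} (hx : 0 ≤ x)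
    (y : ℝ) : ‖dampedKernel k c (y - x) * (V y : ℂ)‖ ≤ C * |V y| := by
  refine (norm_dampedKernel_mul_le hV hC hx y).trans ?_
  by_cases hy : y ∈ Ioi x
  · have : Real.exp (-c * (y - x)) ≤ 1 := by
      rw [Real.exp_le_one_iff]
      nlinarith [mem_Ioi.1 hy]
    rw [indicator_of_mem hy]
    gcongr
    exact mul_le_of_le_one_right (abs_nonneg _) this
  · rw [indicator_of_notMem hy]
    positivity

/-- The damped Jost equation has exactly one continuous solution for suitable damping. -/
lemma exists_existsUnique_damped {b : ℝ} (hb : 0 < b) {V : ℝ → ℝ} (hV : ClassA b V) (k : ℂ) :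
    ∃ c : ℝ, ∃! u : C(Icc 0 b, ℂ), ∀ x : Icc 0 b,
      u x = Complex.exp (c * x) * Complex.exp (Complex.I * k * x)
        + ∫ y, dampedKernel k c (y - x) * (V y : ℂ) * u (projIcc 0 b hb.le y) := by
  obtain ⟨C, hC⟩ := isCompact_Icc.exists_bound_of_continuousOn
    (s := Icc 0 b) (continuous_jostKernel k).continuousOn
  have hC0 : 0 ≤ C := (norm_nonneg _).trans (hC 0 ⟨le_rfl, hb.le⟩)
  have hε : 0 < 1 / (2 * (C + 1)) := by positivity
  obtain ⟨c, hc, hcV⟩ := hV.integrable.exists_integral_exp_decay_le hε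
  refine ⟨c, ?_⟩
  have hmeas (u : C(Icc 0 b, ℂ)) (x : ℝ) : AEStronglyMeasurable
      (fun y => dampedKernel k c (y - x) * (V y : ℂ) * u (projIcc 0 b hb.le y)) := by
    have h1 : Continuous fun y => dampedKernel k c (y - x) :=
      (continuous_dampedKernel k c).comp (by fun_prop)
    have h2 : Continuous fun y => u (projIcc 0 b hb.le y) := u.continuous.comp continuous_projIcc
    have h3 : Measurable fun y => (V y : ℂ) := Complex.measurable_ofReal.comp hV.1
    exact ((h1.measurable.mul h3).mul h2.measurable).aestronglyMeasurable
  have hbound (u : C(Icc 0 b, ℂ)) (x : Icc 0 b) (y : ℝ) :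
      ‖dampedKernel k c (y - x) * (V y : ℂ) * u (projIcc 0 b hb.le y)‖ ≤ C * |V y| * ‖u‖ := by
    rw [norm_mul]
    gcongr
    · exact norm_dampedKernel_mul_le_const_mul hV hc hC0 hC x.2.1 y
    · exact u.norm_coe_le_norm _
  have hdom (u : C(Icc 0 b, ℂ)) : Integrable fun y => C * |V y| * ‖u‖ :=
    (hV.integrable.abs.const_mul C).mul_const _
  have hcont (u : C(Icc 0 b, ℂ)) : Continuous fun x : Icc 0 b =>
      ∫ y, dampedKernel k c (y - x) * (V y : ℂ) * u (projIcc 0 b hb.le y) := by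
    refine continuous_of_dominated (fun x => hmeas u x)
      (fun x => .of_forall (hbound u x)) (hdom u) (.of_forall fun y => ?_)
    have : Continuous fun x : Icc 0 b => dampedKernel k c (y - x) :=
      (continuous_dampedKernel k c).comp (by fun_prop)
    fun_prop
  let T (u : C(Icc 0 b, ℂ)) : C(Icc 0 b, ℂ) :=
    ⟨fun x => Complex.exp (c * x) * Complex.exp (Complex.I * k * x)
        + ∫ y, dampedKernel k c (y - x) * (V y : ℂ) * u (projIcc 0 b hb.le y),
      (by fun_prop : Continuous fun x : Icc 0 b =>
        Complex.exp (c * x) * Complex.exp (Complex.I * k * x)).add (hcont u)⟩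
  have hT : ContractingWith (1 / 2) T := by
    refine ⟨by rw [← NNReal.coe_lt_coe]; norm_num, LipschitzWith.of_dist_le_mul fun u v => ?_⟩
    refine (ContinuousMap.dist_le (by positivity)).2 fun x => ?_
    have hint (w : C(Icc 0 b, ℂ)) : Integrable
        fun y => dampedKernel k c (y - x) * (V y : ℂ) * w (projIcc 0 b hb.le y) :=
      (hdom w).mono' (hmeas w x) (.of_forall (hbound w x))
    have hdecay : IntegrableOn (fun y => |V y| * Real.exp (-c * (y - x))) (Ioi (x : ℝ)) := by
      refine hV.integrable.abs.integrableOn.mono'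
        (hV.1.abs.mul (by fun_prop)).aestronglyMeasurable ?_
      filter_upwards [ae_restrict_mem measurableSet_Ioi] with y hy
      rw [Real.norm_of_nonneg (by positivity)]
      refine mul_le_of_le_one_right (abs_nonneg _) ?_
      rw [Real.exp_le_one_iff]
      nlinarith [mem_Ioi.1 hy]
    rw [dist_eq_norm]
    simp only [T, ContinuousMap.coe_mk]
    rw [add_sub_add_left_eq_sub, ← integral_sub (hint u) (hint v)]
    calc _ ≤ ∫ y, (Ioi (x : ℝ)).indicator
            (fun y => C * (|V y| * Real.exp (-c * (y - x)))) y * dist u v := by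
          refine norm_integral_le_of_norm_le
            (((integrable_indicator_iff measurableSet_Ioi).2 (hdecay.const_mul C)).mul_const _)
            (.of_forall fun y => ?_)
          rw [← mul_sub, norm_mul, ← dist_eq_norm (u _)]
          have h := norm_dampedKernel_mul_le (c := c) hV hC x.2.1 y
          exact mul_le_mul h (ContinuousMap.dist_apply_le_dist _) dist_nonneg
            ((norm_nonneg _).trans h)
      _ = C * (∫ y in Ioi (x : ℝ), |V y| * Real.exp (-c * (y - x))) * dist u v := by
          rw [integral_mul_const, integral_indicator measurableSet_Ioi, integral_const_mul]
      _ ≤ C * (1 / (2 * (C + 1))) * dist u v := by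
          gcongr
          exact hcV x
      _ ≤ _ := by
          gcongr
          rw [mul_one_div, div_le_iff₀ (by positivity)]
          push_cast
          linarith
  have : Nonempty C(Icc 0 b, ℂ) := ⟨0⟩
  exact ⟨hT.fixedPoint, fun x => (DFunLike.congr_fun hT.fixedPoint_isFixedPt x).symm,
    fun v hv => hT.fixedPoint_unique (ContinuousMap.ext fun x => (hv x).symm)⟩

/-- existence and uniqueness of the Jost solution for every `k ∈ ℂ`. -/
theorem jost_existence_uniqueness (b : ℝ) (hb : 0 < b) (V : ℝ → ℝ) (hV : ClassA b V)
    (k : ℂ) :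
    ∃ f : ℝ → ℂ, IsJostSolution b V k f ∧
      ∀ g : ℝ → ℂ, IsJostSolution b V k g → ∀ x : ℝ, 0 ≤ x → g x = f x := by
  obtain ⟨c, u, hu, huniq⟩ := exists_existsUnique_damped hb hV k
  have hexp (x : ℝ) : Complex.exp (c * x) * Complex.exp (-c * x) = 1 := by
    rw [← Complex.exp_add]; simp
  have hintegral (F : ℝ → ℂ) (w : C(Icc 0 b, ℂ))
      (h : ∀ y : Icc 0 b, w y = Complex.exp (c * y) * F y) {x : ℝ} (hxb : x ≤ b) :
      Complex.exp (c * x) * ∫ y in x..b, jostKernel k (y - x) * (V y : ℂ) * F y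
        = ∫ y, dampedKernel k c (y - x) * (V y : ℂ) * w (projIcc 0 b hb.le y) := by
    rw [exp_mul_integral_jostKernel hV k c F hxb]
    congr 1 with y
    by_cases hy : y ∈ Ioo 0 b
    · rw [h, projIcc_of_mem hb.le (Ioo_subset_Icc_self hy)]
    · simp [hV.2.2 y hy]
  let f (x : ℝ) : ℂ := if x ≤ b then Complex.exp (-c * x) * u (projIcc 0 b hb.le x)
    else Complex.exp (Complex.I * k * x)
  have hfu (x : Icc 0 b) : u x = Complex.exp (c * x) * f x := by
    simp only [f, if_pos x.2.2, projIcc_val]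
    rw [← mul_assoc, hexp, one_mul]
  have heq (x : ℝ) (hx : 0 ≤ x) (hxb : x ≤ b) : f x = Complex.exp (Complex.I * k * x)
      + ∫ y in x..b, jostKernel k (y - x) * (V y : ℂ) * f y := by
    refine mul_left_cancel₀ (Complex.exp_ne_zero (c * x)) ?_
    rw [mul_add, hintegral f u hfu hxb, ← hfu ⟨x, hx, hxb⟩, hu ⟨x, hx, hxb⟩]
  have hfb : f b = Complex.exp (Complex.I * k * b) := by
    simpa using heq b hb.le le_rfl
  refine ⟨f, ⟨Continuous.continuousOn ?_, heq, fun x hx => ?_⟩, fun g hg x hx => ?_⟩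
  · have := u.continuous.comp (continuous_projIcc (h := hb.le))
    refine Continuous.if_le (.mul (by fun_prop) this) (by fun_prop) continuous_id
      continuous_const fun x hx => ?_
    obtain rfl : x = b := hx
    simpa [f] using hfb
  · obtain rfl | hx := hx.eq_or_lt
    · exact hfb
    · simp [f, not_le.2 hx]
  · obtain hxb | hxb := le_or_gt x b
    · let v : C(Icc 0 b, ℂ) := ⟨fun y => Complex.exp (c * y) * g y,
        .mul (by fun_prop) (hg.1.comp_continuous continuous_subtype_val fun y => y.2.1)⟩
      have hv : v = u := huniq v fun y => by
        rw [← hintegral g v (fun _ => rfl) y.2.2, ← mul_add, ← hg.2.1 y y.2.1 y.2.2]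
        rfl
      refine mul_left_cancel₀ (Complex.exp_ne_zero (c * x)) ?_
      rw [← hfu ⟨x, hx, hxb⟩, ← hv]
      rfl
    · rw [hg.2.2 x hxb.le]
      simp [f, not_le.2 hxb]
end

section
/- Suppose f : ℂ × [0,∞) → ℂ is such that for every k ∈ ℂ the function f(k,·) is continuous and satisfies the Jost integral equation f(k,x) = e^{ikx} + ∫_x^b s_k(y−x) V(y) f(k,y) dy for 0 ≤ x ≤ b and f(k,x) = e^{ikx} for x ≥ b. Then for each fixed x ≥ 0 the map k ↦ f(k,x) is entire (complex differentiable on all of ℂ). -/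
open MeasureTheory Set Filter

/-- A parametric integral of entire functions is entire, provided the integrand is dominated by
an integrable function locally uniformly in the parameter. -/
lemma differentiable_integral_of_locally_dominated {α : Type*} [MeasurableSpace α]
    {μ : Measure α} {F : ℂ → α → ℂ} (hmeas : ∀ k, AEStronglyMeasurable (F k) μ)
    (hdiff : ∀ᵐ a ∂μ, Differentiable ℂ (fun k => F k a))
    (hbound : ∀ R : ℝ, ∃ g : α → ℝ, Integrable g μ ∧ ∀ᵐ a ∂μ, ∀ k, ‖k‖ ≤ R → ‖F k a‖ ≤ g a) :
    Differentiable ℂ (fun k => ∫ a, F k a ∂μ) := by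
  intro k₀
  obtain ⟨g, hg, hFg⟩ := hbound (‖k₀‖ + 2)
  have hmeas' : AEStronglyMeasurable (fun a => deriv (fun k => F k a) k₀) μ := by
    refine aestronglyMeasurable_of_tendsto_ae (nhdsWithin (0 : ℂ) {0}ᶜ)
      (f := fun t a => t⁻¹ • (F (k₀ + t) a - F k₀ a)) (fun t => ?_) ?_
    · exact ((hmeas (k₀ + t)).sub (hmeas k₀)).const_smul t⁻¹
    · filter_upwards [hdiff] with a ha
      exact (ha k₀).hasDerivAt.tendsto_slope_zero
  refine (hasDerivAt_integral_of_dominated_loc_of_deriv_le (s := Metric.ball k₀ 1) (bound := g)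
    (F' := fun k a => deriv (fun k => F k a) k) (Metric.ball_mem_nhds k₀ one_pos)
    (Eventually.of_forall hmeas) ?_ hmeas' ?_ hg ?_).2.differentiableAt
  · refine hg.mono' (hmeas k₀) ?_
    filter_upwards [hFg] with a ha
    exact ha k₀ (by linarith)
  · filter_upwards [hdiff, hFg] with a hd ha k hk
    have := Complex.norm_deriv_le_of_forall_mem_sphere_norm_le (c := k) (C := g a) one_pos
      (f := fun k => F k a) hd.diffContOnCl (fun z hz => ha z ?_)
    · simpa using this
    · rw [Metric.mem_ball, dist_eq_norm] at hk
      rw [mem_sphere_iff_norm] at hz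
      calc ‖z‖ = ‖(z - k) + (k - k₀) + k₀‖ := by ring_nf
        _ ≤ ‖z - k‖ + ‖k - k₀‖ + ‖k₀‖ := norm_add₃_le
        _ ≤ ‖k₀‖ + 2 := by linarith
  · filter_upwards [hdiff] with a hd k _
    exact (hd k).hasDerivAt

lemma AbsolutelyContinuousOnInterval.pow {f : ℝ → ℝ} {a b : ℝ}
    (hf : AbsolutelyContinuousOnInterval f a b) (n : ℕ) :
    AbsolutelyContinuousOnInterval (fun x => f x ^ (n + 1)) a b := by
  induction n with
  | zero => simpa using hf
  | succ n ih => simpa only [pow_succ _ (n + 1)] using ih.fun_mul hf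

lemma integral_mul_tail_pow {g : ℝ → ℝ} {x b : ℝ} (hg : IntervalIntegrable g volume x b) (n : ℕ) :
    ∫ y in x..b, g y * (∫ t in y..b, g t) ^ n = (∫ t in x..b, g t) ^ (n + 1) / (n + 1) := by
  have hac : AbsolutelyContinuousOnInterval (fun y => ∫ t in b..y, g t) x b :=
    hg.absolutelyContinuousOnInterval_intervalIntegral right_mem_uIcc
  have hint := (hac.neg.pow n).integral_deriv_eq_sub
  have hae : ∫ y in x..b, deriv (fun y => (-fun z => ∫ t in b..z, g t) y ^ (n + 1)) y
      = ∫ y in x..b, -((n : ℝ) + 1) * (g y * (∫ t in y..b, g t) ^ n) := by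
    apply intervalIntegral.integral_congr_ae
    filter_upwards [hg.ae_hasDerivAt_integral] with y hy hmem
    have h := ((hy (uIoc_subset_uIcc hmem) b right_mem_uIcc).neg.pow (n + 1)).deriv
    rw [intervalIntegral.integral_symm b y]
    refine h.trans ?_
    simp only [Pi.neg_apply, Nat.add_sub_cancel]
    push_cast
    ring
  rw [hae, intervalIntegral.integral_const_mul] at hint
  simp only [Pi.neg_apply, intervalIntegral.integral_same, neg_zero, ne_eq, Nat.succ_ne_zero,
    not_false_eq_true, zero_pow, ← intervalIntegral.integral_symm] at hint
  have : (n : ℝ) + 1 ≠ 0 := by positivity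
  field_simp
  linarith

lemma measurable_jostKernel (k : ℂ) : Measurable (jostKernel k) := by
  unfold jostKernel
  split_ifs <;> fun_prop

lemma differentiable_jostKernel (t : ℝ) : Differentiable ℂ (fun k => jostKernel k t) := by
  have h : (fun k => jostKernel k t) = dslope (fun k : ℂ => Complex.sin (k * t)) 0 := by
    funext k
    by_cases hk : k = 0
    · have hd : HasDerivAt (fun k : ℂ => Complex.sin (k * t)) (Complex.cos (0 * t) * (1 * t)) 0 :=
        ((hasDerivAt_id (0 : ℂ)).mul_const (t : ℂ)).csin
      simp [hk, jostKernel, hd.deriv]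
    · rw [dslope_of_ne _ hk]
      simp [jostKernel, hk, slope_def_field]
  rw [h, ← differentiableOn_univ, Complex.differentiableOn_dslope univ_mem]
  fun_prop

lemma norm_cos_le_exp_norm (z : ℂ) : ‖Complex.cos z‖ ≤ Real.exp ‖z‖ := by
  rw [Complex.cos, norm_div, Complex.norm_ofNat, div_le_iff₀ two_pos]
  refine (norm_add_le _ _).trans ?_
  have h₁ := Complex.norm_exp_le_exp_norm (z * Complex.I)
  have h₂ := Complex.norm_exp_le_exp_norm (-z * Complex.I)
  simp only [norm_mul, norm_neg, Complex.norm_I, mul_one] at h₁ h₂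
  linarith

lemma norm_sin_le_mul_exp_norm (z : ℂ) : ‖Complex.sin z‖ ≤ ‖z‖ * Real.exp ‖z‖ := by
  have h := (convex_closedBall (0 : ℂ) ‖z‖).norm_image_sub_le_of_norm_deriv_le
    (f := Complex.sin) (C := Real.exp ‖z‖) (x := 0) (y := z)
    (fun w _ => Complex.differentiable_sin w) (fun w hw => ?_) (by simp) (by simp)
  · simpa [mul_comm] using h
  · rw [Complex.deriv_sin]
    exact (norm_cos_le_exp_norm w).trans (Real.exp_le_exp.2 (by simpa using hw))

lemma norm_jostKernel_le {k : ℂ} {R b t : ℝ} (hk : ‖k‖ ≤ R) (ht : 0 ≤ t) (htb : t ≤ b) :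
    ‖jostKernel k t‖ ≤ b * Real.exp (R * b) := by
  have hexp : Real.exp (‖k‖ * t) ≤ Real.exp (R * b) := by
    have := (norm_nonneg k).trans hk
    gcongr
  have key : ‖jostKernel k t‖ ≤ t * Real.exp (‖k‖ * t) := by
    unfold jostKernel
    split_ifs with h
    · simp [h, abs_of_nonneg ht]
    · have hk0 : 0 < ‖k‖ := norm_pos_iff.2 h
      have hs := norm_sin_le_mul_exp_norm (k * t)
      rw [norm_mul, Complex.norm_real, Real.norm_of_nonneg ht] at hs
      rw [norm_div, div_le_iff₀ hk0]
      linarith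
  have := ht.trans htb
  exact key.trans (by gcongr)

/-- The Volterra operator `h ↦ ∫_x^b s_k(y - x) V(y) h(y) dy` of the Jost integral equation. -/
noncomputable def jostVolterra (b : ℝ) (V : ℝ → ℝ) (k : ℂ) (h : ℝ → ℂ) (x : ℝ) : ℂ :=
  ∫ y in Ioc x b, jostKernel k (y - x) * (V y : ℂ) * h y

section Volterra

variable {b : ℝ} {V : ℝ → ℝ}

lemma measurable_jostVolterra (hV : Measurable V) (k : ℂ) {h : ℝ → ℂ} (hh : Measurable h) :
    Measurable (jostVolterra b V k h) := by
  have hK := measurable_jostKernel k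
  have hset : MeasurableSet {p : ℝ × ℝ | p.1 < p.2 ∧ p.2 ≤ b} :=
    (measurableSet_lt measurable_fst measurable_snd).inter
      (measurableSet_le measurable_snd measurable_const)
  have hm : StronglyMeasurable (Function.uncurry fun x y : ℝ =>
      (Ioc x b).indicator (fun y => jostKernel k (y - x) * (V y : ℂ) * h y) y) := by
    have : Measurable fun p : ℝ × ℝ => jostKernel k (p.2 - p.1) * (V p.2 : ℂ) * h p.2 := by
      fun_prop
    exact (this.indicator hset).stronglyMeasurable
  have heq : jostVolterra b V k h = fun x => ∫ y,
      (Ioc x b).indicator (fun y => jostKernel k (y - x) * (V y : ℂ) * h y) y := by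
    funext x
    exact (integral_indicator measurableSet_Ioc).symm
  rw [heq]
  exact hm.integral_prod_right.measurable

lemma jostVolterra_congr (k : ℂ) {h₁ h₂ : ℝ → ℂ} (h : EqOn h₁ h₂ (Icc 0 b)) {x : ℝ} (hx : 0 ≤ x) :
    jostVolterra b V k h₁ x = jostVolterra b V k h₂ x := by
  refine setIntegral_congr_fun measurableSet_Ioc fun y hy => ?_
  simp only [h ⟨hx.trans hy.1.le, hy.2⟩]

lemma norm_jostVolterra_integrand_le {k : ℂ} {R : ℝ} (hk : ‖k‖ ≤ R) {h : ℝ → ℂ} {x y : ℝ}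
    (hx : 0 ≤ x) (hy : y ∈ Ioc x b) :
    ‖jostKernel k (y - x) * (V y : ℂ) * h y‖ ≤ b * Real.exp (R * b) * |V y| * ‖h y‖ := by
  rw [norm_mul, norm_mul, Complex.norm_real, Real.norm_eq_abs]
  have := norm_jostKernel_le (t := y - x) (b := b) hk (by linarith [hy.1]) (by linarith [hy.2])
  gcongr

lemma integrableOn_jostVolterra_integrand (hV : Integrable V) (hVm : Measurable V) (k : ℂ)
    {h : ℝ → ℂ} (hh : Measurable h) {B : ℝ} (hB : ∀ y ∈ Icc 0 b, ‖h y‖ ≤ B) {x : ℝ} (hx : 0 ≤ x) :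
    IntegrableOn (fun y => jostKernel k (y - x) * (V y : ℂ) * h y) (Ioc x b) := by
  have hK := measurable_jostKernel k
  refine Integrable.mono' (g := fun y => b * Real.exp (‖k‖ * b) * |V y| * B)
    ((hV.abs.const_mul _).mul_const _).integrableOn ?_ ?_
  · exact (by fun_prop : Measurable _).aestronglyMeasurable
  · filter_upwards [ae_restrict_mem measurableSet_Ioc] with y hy
    have hyb : y ∈ Icc 0 b := ⟨hx.trans hy.1.le, hy.2⟩
    have hb := hyb.1.trans hyb.2
    refine (norm_jostVolterra_integrand_le le_rfl hx hy).trans ?_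
    gcongr
    exact hB y hyb

lemma jostVolterra_add (hV : Integrable V) (hVm : Measurable V) (k : ℂ) {h₁ h₂ : ℝ → ℂ}
    (hm₁ : Measurable h₁) (hm₂ : Measurable h₂) {B₁ B₂ : ℝ} (hB₁ : ∀ y ∈ Icc 0 b, ‖h₁ y‖ ≤ B₁)
    (hB₂ : ∀ y ∈ Icc 0 b, ‖h₂ y‖ ≤ B₂) {x : ℝ} (hx : 0 ≤ x) :
    jostVolterra b V k (h₁ + h₂) x = jostVolterra b V k h₁ x + jostVolterra b V k h₂ x := by
  unfold jostVolterra
  rw [← integral_add (integrableOn_jostVolterra_integrand hV hVm k hm₁ hB₁ hx)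
    (integrableOn_jostVolterra_integrand hV hVm k hm₂ hB₂ hx)]
  simp only [Pi.add_apply, mul_add]

/-- The weight `C ∫_x^b |V|` controlling the iterates of the Volterra operator, where `C` bounds
the kernel for `‖k‖ ≤ R`. -/
noncomputable def jostWeight (b : ℝ) (V : ℝ → ℝ) (R x : ℝ) : ℝ :=
  ∫ t in x..b, b * Real.exp (R * b) * |V t|

lemma jostWeight_nonneg (R : ℝ) {x : ℝ} (hx : x ∈ Icc 0 b) : 0 ≤ jostWeight b V R x := by
  have := hx.1.trans hx.2
  exact intervalIntegral.integral_nonneg hx.2 fun t _ => by positivity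

lemma jostWeight_le (hV : Integrable V) (R : ℝ) {x : ℝ} (hx : x ∈ Icc 0 b) :
    jostWeight b V R x ≤ jostWeight b V R 0 := by
  have := hx.1.trans hx.2
  refine intervalIntegral.integral_mono_interval hx.1 hx.2 le_rfl
    (Eventually.of_forall fun t => ?_) (hV.abs.const_mul _).intervalIntegrable
  simp only [Pi.zero_apply]
  positivity

lemma continuous_jostWeight (hV : Integrable V) (R : ℝ) : Continuous (jostWeight b V R) := by
  have : jostWeight b V R = fun x => -∫ t in b..x, b * Real.exp (R * b) * |V t| :=
    funext fun x => intervalIntegral.integral_symm b x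
  rw [this]
  exact (intervalIntegral.continuous_primitive
    (fun _ _ => (hV.abs.const_mul _).intervalIntegrable) b).neg

lemma norm_jostVolterra_le (hV : Integrable V) {k : ℂ} {R : ℝ} (hk : ‖k‖ ≤ R) {h : ℝ → ℂ}
    {M : ℝ} {n : ℕ} (hh : ∀ y ∈ Icc 0 b, ‖h y‖ ≤ M * (jostWeight b V R y ^ n / n.factorial))
    {x : ℝ} (hx : x ∈ Icc 0 b) :
    ‖jostVolterra b V k h x‖ ≤ M * (jostWeight b V R x ^ (n + 1) / (n + 1).factorial) := by
  have hb := hx.1.trans hx.2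
  set g : ℝ → ℝ := fun t => b * Real.exp (R * b) * |V t| with hg
  have hgi : Integrable g := hV.abs.const_mul _
  have hint : IntervalIntegrable (fun y => g y * jostWeight b V R y ^ n) volume x b :=
    hgi.intervalIntegrable.mul_continuousOn ((continuous_jostWeight hV R).pow n).continuousOn
  have hval : ∫ y in x..b, g y * jostWeight b V R y ^ n
      = jostWeight b V R x ^ (n + 1) / (n + 1) :=
    integral_mul_tail_pow hgi.intervalIntegrable n
  have hle : ‖jostVolterra b V k h x‖
      ≤ ∫ y in Ioc x b, M / n.factorial * (g y * jostWeight b V R y ^ n) := by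
    refine norm_integral_le_of_norm_le (hint.1.const_mul _) ?_
    filter_upwards [ae_restrict_mem measurableSet_Ioc] with y hy
    refine (norm_jostVolterra_integrand_le hk hx.1 hy).trans ?_
    calc g y * ‖h y‖ ≤ g y * (M * (jostWeight b V R y ^ n / n.factorial)) := by
          have := hh y ⟨hx.1.trans hy.1.le, hy.2⟩
          gcongr
      _ = M / n.factorial * (g y * jostWeight b V R y ^ n) := by ring
  refine hle.trans_eq ?_
  rw [← intervalIntegral.integral_of_le hx.2, intervalIntegral.integral_const_mul, hval,
    Nat.factorial_succ]
  push_cast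
  field_simp

lemma norm_iterate_jostVolterra_le (hV : Integrable V) {k : ℂ} {R : ℝ} (hk : ‖k‖ ≤ R)
    {h : ℝ → ℂ} {M : ℝ} (hh : ∀ y ∈ Icc 0 b, ‖h y‖ ≤ M) (n : ℕ) :
    ∀ x ∈ Icc 0 b,
      ‖(jostVolterra b V k)^[n] h x‖ ≤ M * (jostWeight b V R x ^ n / n.factorial) := by
  induction n with
  | zero => simpa using hh
  | succ n ih =>
    intro x hx
    rw [Function.iterate_succ_apply']
    exact norm_jostVolterra_le hV hk ih hx

lemma norm_iterate_jostVolterra_le_const (hV : Integrable V) {k : ℂ} {R : ℝ} (hk : ‖k‖ ≤ R)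
    {h : ℝ → ℂ} {M : ℝ} (hh : ∀ y ∈ Icc 0 b, ‖h y‖ ≤ M) (n : ℕ) :
    ∀ x ∈ Icc 0 b,
      ‖(jostVolterra b V k)^[n] h x‖ ≤ M * (jostWeight b V R 0 ^ n / n.factorial) := by
  intro x hx
  have hM : 0 ≤ M := (norm_nonneg _).trans (hh x hx)
  refine (norm_iterate_jostVolterra_le hV hk hh n x hx).trans ?_
  have := jostWeight_nonneg (V := V) R hx
  have := jostWeight_le hV R hx
  gcongr

lemma measurable_iterate_jostVolterra (hVm : Measurable V) (k : ℂ) {h : ℝ → ℂ}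
    (hh : Measurable h) (n : ℕ) : Measurable ((jostVolterra b V k)^[n] h) := by
  induction n with
  | zero => simpa using hh
  | succ n ih =>
    rw [Function.iterate_succ_apply']
    exact measurable_jostVolterra hVm k ih

lemma iterate_jostVolterra_eq_add (hV : Integrable V) (hVm : Measurable V) {k : ℂ} {e f : ℝ → ℂ}
    (he : Measurable e) (hf : Measurable f) {B₁ B₂ : ℝ} (hB₁ : ∀ y ∈ Icc 0 b, ‖e y‖ ≤ B₁)
    (hB₂ : ∀ y ∈ Icc 0 b, ‖f y‖ ≤ B₂)
    (heq : ∀ x ∈ Icc 0 b, f x = e x + jostVolterra b V k f x) (n : ℕ) :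
    ∀ x ∈ Icc 0 b, (jostVolterra b V k)^[n] f x
      = (jostVolterra b V k)^[n] e x + (jostVolterra b V k)^[n + 1] f x := by
  induction n with
  | zero => simpa using heq
  | succ n ih =>
    intro x hx
    rw [Function.iterate_succ_apply', Function.iterate_succ_apply' _ n e,
      Function.iterate_succ_apply' _ (n + 1) f,
      ← jostVolterra_add hV hVm k (measurable_iterate_jostVolterra hVm k he n)
      (measurable_iterate_jostVolterra hVm k hf (n + 1))
      (norm_iterate_jostVolterra_le_const hV le_rfl hB₁ n)
      (norm_iterate_jostVolterra_le_const hV le_rfl hB₂ (n + 1)) hx.1]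
    exact jostVolterra_congr k ih hx.1

/-- The Neumann series of a Volterra equation converges to any bounded solution. -/
lemma hasSum_iterate_jostVolterra (hV : Integrable V) (hVm : Measurable V) {k : ℂ}
    {e f : ℝ → ℂ} (he : Measurable e) (hf : Measurable f) {B₁ B₂ : ℝ}
    (hB₁ : ∀ y ∈ Icc 0 b, ‖e y‖ ≤ B₁) (hB₂ : ∀ y ∈ Icc 0 b, ‖f y‖ ≤ B₂)
    (heq : ∀ x ∈ Icc 0 b, f x = e x + jostVolterra b V k f x) {x : ℝ} (hx : x ∈ Icc 0 b) :
    HasSum (fun n => (jostVolterra b V k)^[n] e x) (f x) := by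
  have hsum : Summable fun n => (jostVolterra b V k)^[n] e x :=
    .of_norm_bounded ((Real.summable_pow_div_factorial _).mul_left B₁)
      fun n => norm_iterate_jostVolterra_le hV le_rfl hB₁ n x hx
  have hpartial (n : ℕ) : ∑ j ∈ Finset.range n, (jostVolterra b V k)^[j] e x
      = f x - (jostVolterra b V k)^[n] f x := by
    induction n with
    | zero => simp
    | succ n ih =>
      rw [Finset.sum_range_succ, ih, iterate_jostVolterra_eq_add hV hVm he hf hB₁ hB₂ heq n x hx]
      ring
  have hzero : Tendsto (fun n => (jostVolterra b V k)^[n] f x) atTop (nhds 0) := by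
    refine squeeze_zero_norm (fun n => norm_iterate_jostVolterra_le hV le_rfl hB₂ n x hx) ?_
    simpa using (FloorSemiring.tendsto_pow_div_factorial_atTop _).const_mul B₂
  refine hsum.hasSum_iff_tendsto_nat.2 ?_
  simp only [hpartial]
  simpa using hzero.const_sub (f x)

lemma differentiable_jostVolterra (hV : Integrable V) (hVm : Measurable V) {h : ℂ → ℝ → ℂ}
    (hm : ∀ k, Measurable (h k)) (hd : ∀ y ∈ Icc 0 b, Differentiable ℂ fun k => h k y)
    (hB : ∀ R : ℝ, ∃ B : ℝ, ∀ k, ‖k‖ ≤ R → ∀ y ∈ Icc 0 b, ‖h k y‖ ≤ B) {x : ℝ} (hx : 0 ≤ x) :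
    Differentiable ℂ fun k => jostVolterra b V k (h k) x := by
  refine differentiable_integral_of_locally_dominated (fun k => ?_) ?_ fun R => ?_
  · have hK := measurable_jostKernel k
    have := hm k
    exact (by fun_prop : Measurable _).aestronglyMeasurable
  · filter_upwards [ae_restrict_mem measurableSet_Ioc] with y hy
    exact ((differentiable_jostKernel _).mul_const _).mul (hd y ⟨hx.trans hy.1.le, hy.2⟩)
  · obtain ⟨B, hB⟩ := hB R
    refine ⟨fun y => b * Real.exp (R * b) * |V y| * B,
      ((hV.abs.const_mul _).mul_const _).integrableOn, ?_⟩
    filter_upwards [ae_restrict_mem measurableSet_Ioc] with y hy k hk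
    have hyb : y ∈ Icc 0 b := ⟨hx.trans hy.1.le, hy.2⟩
    have hb := hyb.1.trans hyb.2
    refine (norm_jostVolterra_integrand_le hk hx hy).trans ?_
    gcongr
    exact hB k hk y hyb

lemma differentiable_iterate_jostVolterra (hV : Integrable V) (hVm : Measurable V)
    {h : ℂ → ℝ → ℂ} (hm : ∀ k, Measurable (h k))
    (hd : ∀ y ∈ Icc 0 b, Differentiable ℂ fun k => h k y)
    (hB : ∀ R : ℝ, ∃ B : ℝ, ∀ k, ‖k‖ ≤ R → ∀ y ∈ Icc 0 b, ‖h k y‖ ≤ B) (n : ℕ) :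
    ∀ x ∈ Icc 0 b, Differentiable ℂ fun k => (jostVolterra b V k)^[n] (h k) x := by
  induction n with
  | zero => simpa using hd
  | succ n ih =>
    intro x hx
    simp only [Function.iterate_succ_apply']
    refine differentiable_jostVolterra hV hVm
      (fun k => measurable_iterate_jostVolterra hVm k (hm k) n) ih (fun R => ?_) hx.1
    obtain ⟨B, hB⟩ := hB R
    exact ⟨_, fun k hk => norm_iterate_jostVolterra_le_const hV hk (hB k hk) n⟩

end Volterra

lemma norm_exp_I_mul_le {k : ℂ} {R b y : ℝ} (hk : ‖k‖ ≤ R) (hy : y ∈ Icc 0 b) :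
    ‖Complex.exp (Complex.I * k * y)‖ ≤ Real.exp (R * b) := by
  refine (Complex.norm_exp_le_exp_norm _).trans (Real.exp_le_exp.2 ?_)
  rw [norm_mul, norm_mul, Complex.norm_I, one_mul, Complex.norm_real, Real.norm_of_nonneg hy.1]
  exact mul_le_mul hk hy.2 hy.1 ((norm_nonneg k).trans hk)

lemma IsJostSolution.hasSum {b : ℝ} {V : ℝ → ℝ} {k : ℂ} {f : ℝ → ℂ} (hV : ClassA b V)
    (hf : IsJostSolution b V k f) {x : ℝ} (hx : x ∈ Icc 0 b) :
    HasSum (fun n => (jostVolterra b V k)^[n] (fun y => Complex.exp (Complex.I * k * y)) x)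
      (f x) := by
  have hcont : Continuous fun y => f (max y 0) :=
    hf.1.comp_continuous (by fun_prop) fun y => le_max_right y 0
  have hext : EqOn (fun y => f (max y 0)) f (Icc 0 b) := fun y hy => by
    simp only [max_eq_left hy.1]
  obtain ⟨B, hB⟩ := isCompact_Icc.exists_bound_of_continuousOn (hcont.continuousOn (s := Icc 0 b))
  have h := hasSum_iterate_jostVolterra hV.integrable hV.1 (k := k)
    (e := fun y => Complex.exp (Complex.I * k * y)) (by fun_prop) hcont.measurable
    (fun y hy => norm_exp_I_mul_le le_rfl hy) hB (fun y hy => ?_) hx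
  · exact hext hx ▸ h
  · rw [jostVolterra_congr k hext hy.1, jostVolterra, ← intervalIntegral.integral_of_le hy.2]
    exact (hext hy).trans (hf.2.1 y hy.1 hy.2)

/-- for each fixed `x ≥ 0`, the Jost solution is entire in `k`. -/
theorem jost_entire_in_k (b : ℝ) (hb : 0 < b) (V : ℝ → ℝ) (hV : ClassA b V)
    (f : ℂ → ℝ → ℂ) (hf : ∀ k : ℂ, IsJostSolution b V k (f k)) :
    ∀ x : ℝ, 0 ≤ x → Differentiable ℂ (fun k : ℂ => f k x) := by
  intro x hx
  rcases le_total b x with hbx | hxb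
  · simp only [fun k => (hf k).2.2 x hbx]
    fun_prop
  have hmem : x ∈ Icc 0 b := ⟨hx, hxb⟩
  simp only [fun k => ((hf k).hasSum hV hmem).tsum_eq.symm]
  intro k₀
  have hsum := (Real.summable_pow_div_factorial (jostWeight b V (‖k₀‖ + 1) x)).mul_left
    (Real.exp ((‖k₀‖ + 1) * b))
  refine (Complex.differentiableOn_tsum_of_summable_norm (U := Metric.ball 0 (‖k₀‖ + 1)) hsum
    (fun n => ?_) Metric.isOpen_ball fun n k hk => ?_).differentiableAt
    (Metric.isOpen_ball.mem_nhds (by simp))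
  · refine (differentiable_iterate_jostVolterra hV.integrable hV.1
      (h := fun k y => Complex.exp (Complex.I * k * y)) (fun k => by fun_prop)
      (fun y _ => by fun_prop) (fun R => ?_) n x hmem).differentiableOn
    exact ⟨_, fun k hk y hy => norm_exp_I_mul_le hk hy⟩
  · have hk' : ‖k‖ ≤ ‖k₀‖ + 1 := (mem_ball_zero_iff.1 hk).le
    exact norm_iterate_jostVolterra_le hV.integrable hk'
      (fun y hy => norm_exp_I_mul_le hk' hy) n x hmem
end

section
/- Suppose for every k ∈ ℂ with Im k ≥ 0, f(k,·) : [0,∞) → ℂ is a continuous solution of the Jost integral equation, and set f'(k,0) := ik − ∫₀^b cos(ky) V(y) f(k,y) dy. Then, as k → ∞ in the closed upper half plane {Im k ≥ 0}, one has k·( f(k,0) − 1 + W/(2ik) ) → 0 and f'(k,0) − ik + W/2 → 0; that is, f(k,0) = 1 − W/(2ik) + o(1/k) and f'(k,0) = ik − W/2 + o(1). -/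
open MeasureTheory Set Filter

open Complex in
lemma norm_exp_I_mul_le_one {k : ℂ} (hk : 0 ≤ k.im) {t : ℝ} (ht : 0 ≤ t) :
    ‖exp (I * k * t)‖ ≤ 1 := by
  rw [norm_exp, Real.exp_le_one_iff]
  simp only [mul_re, mul_im, I_re, I_im, ofReal_re, ofReal_im]
  nlinarith [mul_nonneg hk ht]

open Complex in
lemma sin_mul_exp_I_mul (z : ℂ) : sin z * exp (I * z) = (exp (I * (2 * z)) - 1) / (2 * I) := by
  have h : exp (-z * I) * exp (I * z) = 1 := by rw [← exp_add]; simp [mul_comm]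
  have h2 : exp (I * (2 * z)) = exp (z * I) * exp (I * z) := by rw [← exp_add]; ring_nf
  rw [h2, sin, eq_div_iff (mul_ne_zero two_ne_zero I_ne_zero)]
  linear_combination exp (I * z) * (exp (-z * I) - exp (z * I)) * I_sq - h

open Complex in
lemma cos_mul_exp_I_mul (z : ℂ) : cos z * exp (I * z) = (exp (I * (2 * z)) + 1) / 2 := by
  have h : exp (-z * I) * exp (I * z) = 1 := by rw [← exp_add]; simp [mul_comm]
  have h2 : exp (I * (2 * z)) = exp (z * I) * exp (I * z) := by rw [← exp_add]; ring_nf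
  rw [h2, ← h, cos]
  ring

open Complex in
lemma norm_exp_I_mul_two_mul_le_one {k : ℂ} (hk : 0 ≤ k.im) {t : ℝ} (ht : 0 ≤ t) :
    ‖exp (I * (2 * (k * t)))‖ ≤ 1 := by
  have := norm_exp_I_mul_le_one hk (t := 2 * t) (by positivity)
  convert this using 3
  push_cast
  ring

open Complex in
lemma norm_sin_mul_exp_I_mul_le_one {k : ℂ} (hk : 0 ≤ k.im) {t : ℝ} (ht : 0 ≤ t) :
    ‖sin (k * t) * exp (I * (k * t))‖ ≤ 1 := by
  rw [sin_mul_exp_I_mul, norm_div]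
  have h := norm_exp_I_mul_two_mul_le_one hk ht
  have h2 := norm_sub_le (exp (I * (2 * (k * t)))) 1
  simp only [norm_mul, norm_I, Complex.norm_two, norm_one] at *
  linarith

open Complex in
lemma norm_cos_mul_exp_I_mul_le_one {k : ℂ} (hk : 0 ≤ k.im) {t : ℝ} (ht : 0 ≤ t) :
    ‖cos (k * t) * exp (I * (k * t))‖ ≤ 1 := by
  rw [cos_mul_exp_I_mul, norm_div]
  have h := norm_exp_I_mul_two_mul_le_one hk ht
  have h2 := norm_add_le (exp (I * (2 * (k * t)))) 1
  simp only [Complex.norm_two, norm_one] at *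
  linarith

/-- For a `C¹` amplitude the oscillatory integral is `O(1/k)`, uniformly on the closed upper half
plane. -/
lemma exists_norm_integral_exp_mul_contDiff_le {b : ℝ} (hb : 0 ≤ b) {g : ℝ → ℂ}
    (hg : ContDiff ℝ 1 g) : ∃ K : ℝ, 0 ≤ K ∧ ∀ k : ℂ, 0 ≤ k.im → k ≠ 0 →
      ‖∫ y in (0:ℝ)..b, g y * Complex.exp (Complex.I * k * y)‖ ≤ K / ‖k‖ := by
  refine ⟨‖g b‖ + ‖g 0‖ + ∫ y in (0:ℝ)..b, ‖deriv g y‖, ?_, fun k hk hk0 ↦ ?_⟩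
  · have := intervalIntegral.integral_nonneg (μ := volume) hb fun y _ ↦ norm_nonneg (deriv g y)
    positivity
  have hIk : Complex.I * k ≠ 0 := mul_ne_zero Complex.I_ne_zero hk0
  have hg' : Continuous (deriv g) := hg.continuous_deriv le_rfl
  have hparts := intervalIntegral.integral_mul_deriv_eq_deriv_mul (a := 0) (b := b)
    (u := g) (u' := deriv g) (v := fun y : ℝ ↦ Complex.exp (Complex.I * k * y) / (Complex.I * k))
    (v' := fun y : ℝ ↦ Complex.exp (Complex.I * k * y))
    (fun x _ ↦ (hg.differentiable one_ne_zero x).hasDerivAt)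
    (fun x _ ↦ by
      have h := ((Complex.ofRealCLM.hasDerivAt (x := x)).const_mul (Complex.I * k)).cexp.div_const
        (Complex.I * k)
      simpa [hIk] using h)
    (hg'.intervalIntegrable _ _) (Continuous.intervalIntegrable (by fun_prop) _ _)
  have hv (y : ℝ) (hy : 0 ≤ y) :
      ‖Complex.exp (Complex.I * k * y) / (Complex.I * k)‖ ≤ 1 / ‖k‖ := by
    rw [norm_div, norm_mul, Complex.norm_I, one_mul]
    gcongr
    exact norm_exp_I_mul_le_one hk hy
  have hint : ‖∫ y in (0:ℝ)..b, deriv g y * (Complex.exp (Complex.I * k * y) / (Complex.I * k))‖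
      ≤ ∫ y in (0:ℝ)..b, ‖deriv g y‖ * (1 / ‖k‖) := by
    refine intervalIntegral.norm_integral_le_of_norm_le hb (ae_of_all _ fun y hy ↦ ?_)
      ((hg'.norm.mul continuous_const).intervalIntegrable _ _)
    rw [norm_mul]
    gcongr
    exact hv y hy.1.le
  rw [intervalIntegral.integral_mul_const] at hint
  rw [hparts]
  grw [norm_sub_le, norm_sub_le, norm_mul_le, norm_mul_le, hint, hv b hb, hv 0 le_rfl]
  exact le_of_eq (by ring)

/-- **Riemann–Lebesgue lemma**, uniformly on the closed upper half plane. -/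
lemma exists_norm_integral_exp_mul_le {b : ℝ} (hb : 0 ≤ b) {v : ℝ → ℂ}
    (hv : IntervalIntegrable v volume 0 b) {ε : ℝ} (hε : 0 < ε) :
    ∃ R : ℝ, 0 < R ∧ ∀ k : ℂ, 0 ≤ k.im → R ≤ ‖k‖ →
      ‖∫ y in (0:ℝ)..b, v y * Complex.exp (Complex.I * k * y)‖ ≤ ε := by
  have hv' : Integrable v (volume.restrict (Ioc 0 b)) :=
    (intervalIntegrable_iff_integrableOn_Ioc_of_le hb).1 hv
  obtain ⟨g, -, hg, hvg⟩ := (memLp_one_iff_integrable.2 hv').exist_eLpNorm_sub_le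
    ENNReal.one_ne_top le_rfl (half_pos hε)
  have hg1 : ContDiff ℝ 1 g := hg.of_le (by exact_mod_cast le_top)
  have hgi : IntervalIntegrable g volume 0 b := hg.continuous.intervalIntegrable _ _
  have hdiff : ∫ y in (0:ℝ)..b, ‖v y - g y‖ ≤ ε / 2 := by
    rw [eLpNorm_one_eq_lintegral_enorm] at hvg
    rw [intervalIntegral.integral_of_le hb, integral_norm_eq_lintegral_enorm
      ((hv.sub hgi).1.aestronglyMeasurable)]
    exact ENNReal.toReal_le_of_le_ofReal (half_pos hε).le hvg
  obtain ⟨K, hK, hKg⟩ := exists_norm_integral_exp_mul_contDiff_le hb hg1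
  refine ⟨2 * K / ε + 1, by positivity, fun k hk hR ↦ ?_⟩
  have hk0 : 0 < ‖k‖ := lt_of_lt_of_le (by positivity) hR
  have he : ContinuousOn (fun y : ℝ ↦ Complex.exp (Complex.I * k * y)) (uIcc 0 b) :=
    Continuous.continuousOn (by fun_prop)
  have hsplit : ∫ y in (0:ℝ)..b, v y * Complex.exp (Complex.I * k * y) =
      (∫ y in (0:ℝ)..b, (v y - g y) * Complex.exp (Complex.I * k * y)) +
        ∫ y in (0:ℝ)..b, g y * Complex.exp (Complex.I * k * y) := by
    rw [← intervalIntegral.integral_add ((hv.sub hgi).mul_continuousOn he)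
      (hgi.mul_continuousOn he)]
    congr 1
    ext y
    ring
  have h1 : ‖∫ y in (0:ℝ)..b, (v y - g y) * Complex.exp (Complex.I * k * y)‖ ≤ ε / 2 := by
    refine (intervalIntegral.norm_integral_le_of_norm_le hb (ae_of_all _ fun y hy ↦ ?_)
      (hv.sub hgi).norm).trans hdiff
    rw [norm_mul]
    exact mul_le_of_le_one_right (norm_nonneg _) (norm_exp_I_mul_le_one hk hy.1.le)
  have h2 : K / ‖k‖ ≤ ε / 2 := by
    rw [div_le_iff₀ hk0]
    have : 2 * K / ε * ε = 2 * K := by field_simp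
    nlinarith
  rw [hsplit]
  linarith [norm_add_le (∫ y in (0:ℝ)..b, (v y - g y) * Complex.exp (Complex.I * k * y))
    (∫ y in (0:ℝ)..b, g y * Complex.exp (Complex.I * k * y)), hKg k hk (norm_pos_iff.1 hk0)]

lemma ClassA.intervalIntegrable {b : ℝ} {V : ℝ → ℝ} (hV : ClassA b V) (hb : 0 ≤ b) :
    IntervalIntegrable V volume 0 b :=
  (intervalIntegrable_iff_integrableOn_Ioo_of_le hb).2 hV.2.1

section Jost

variable {b : ℝ} {V : ℝ → ℝ} {k : ℂ} {f : ℝ → ℂ}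

lemma IsJostSolution.norm_exp_neg_mul_sub_one_le_of_bound (hf : IsJostSolution b V k f)
    (hV : IntervalIntegrable V volume 0 b) (hk : 0 ≤ k.im) (hk0 : k ≠ 0) {M : ℝ} (hM0 : 0 ≤ M)
    (hM : ∀ y ∈ Icc 0 b, ‖Complex.exp (-(Complex.I * k * y)) * f y‖ ≤ M) {x : ℝ}
    (hx : x ∈ Icc 0 b) :
    ‖Complex.exp (-(Complex.I * k * x)) * f x - 1‖ ≤ (∫ y in (0:ℝ)..b, |V y|) * M / ‖k‖ := by
  have hVx : IntervalIntegrable V volume x b :=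
    hV.mono_set (by
      rw [uIcc_of_le hx.2, uIcc_of_le (hx.1.trans hx.2)]
      exact Icc_subset_Icc_left hx.1)
  have heq : Complex.exp (-(Complex.I * k * x)) * f x - 1 = ∫ y in x..b,
      Complex.exp (-(Complex.I * k * x)) * (jostKernel k (y - x) * (V y : ℂ) * f y) := by
    rw [intervalIntegral.integral_const_mul, hf.2.1 x hx.1 hx.2, mul_add, ← Complex.exp_add]
    simp
  have hbound : ‖Complex.exp (-(Complex.I * k * x)) * f x - 1‖ ≤
      ∫ y in x..b, |V y| * (M / ‖k‖) := by
    rw [heq]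
    refine intervalIntegral.norm_integral_le_of_norm_le hx.2 (ae_of_all _ fun y hy ↦ ?_)
      (hVx.abs.mul_const _)
    have hfac : Complex.exp (-(Complex.I * k * x)) * (jostKernel k (y - x) * (V y : ℂ) * f y) =
        (V y : ℂ) * (Complex.sin (k * (y - x : ℝ)) * Complex.exp (Complex.I * (k * (y - x : ℝ)))
          * (Complex.exp (-(Complex.I * k * y)) * f y) / k) := by
      have : Complex.exp (-(Complex.I * k * x)) =
          Complex.exp (Complex.I * (k * (y - x : ℝ))) * Complex.exp (-(Complex.I * k * y)) := by
        rw [← Complex.exp_add]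
        push_cast
        ring_nf
      rw [this, jostKernel, if_neg hk0]
      push_cast
      ring
    rw [hfac, norm_mul, norm_div, norm_mul _ (_ * f y), Complex.norm_real, Real.norm_eq_abs]
    gcongr
    exact (mul_le_of_le_one_left (norm_nonneg _)
      (norm_sin_mul_exp_I_mul_le_one hk (sub_nonneg.2 hy.1.le))).trans
      (hM y ⟨hx.1.trans hy.1.le, hy.2⟩)
  rw [intervalIntegral.integral_mul_const] at hbound
  refine hbound.trans ?_
  rw [mul_div_assoc]
  gcongr
  exact intervalIntegral.integral_mono_interval hx.1 hx.2 le_rfl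
    (ae_of_all _ fun y ↦ abs_nonneg (V y)) hV.abs

lemma IsJostSolution.norm_exp_neg_mul_sub_one_le (hf : IsJostSolution b V k f)
    (hV : IntervalIntegrable V volume 0 b) (hk : 0 ≤ k.im) (hk0 : k ≠ 0)
    (hkV : 2 * (∫ y in (0:ℝ)..b, |V y|) ≤ ‖k‖) {x : ℝ} (hx : x ∈ Icc 0 b) :
    ‖Complex.exp (-(Complex.I * k * x)) * f x - 1‖ ≤ 2 * (∫ y in (0:ℝ)..b, |V y|) / ‖k‖ := by
  have hkpos : 0 < ‖k‖ := norm_pos_iff.2 hk0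
  have hC : 0 ≤ ∫ y in (0:ℝ)..b, |V y| :=
    intervalIntegral.integral_nonneg (hx.1.trans hx.2) fun y _ ↦ abs_nonneg (V y)
  have hcont : ContinuousOn (fun y : ℝ ↦ ‖Complex.exp (-(Complex.I * k * y)) * f y‖) (Icc 0 b) :=
    ((Continuous.continuousOn (by fun_prop)).mul (hf.1.mono Icc_subset_Ici_self)).norm
  obtain ⟨z, hz, hmax⟩ := isCompact_Icc.exists_isMaxOn ⟨x, hx⟩ hcont
  set M := ‖Complex.exp (-(Complex.I * k * z)) * f z‖
  have hbound {y : ℝ} (hy : y ∈ Icc 0 b) := hf.norm_exp_neg_mul_sub_one_le_of_bound hV hk hk0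
    (norm_nonneg _) (fun y hy ↦ hmax hy) hy
  have hM2 : M ≤ 2 := by
    have h1 := hbound hz
    have h2 := norm_sub_norm_le (Complex.exp (-(Complex.I * k * z)) * f z) 1
    have h3 : (∫ y in (0:ℝ)..b, |V y|) * M / ‖k‖ ≤ M / 2 := by
      rw [div_le_iff₀ hkpos]
      nlinarith [norm_nonneg (Complex.exp (-(Complex.I * k * z)) * f z)]
    rw [norm_one] at h2
    linarith
  refine (hbound hx).trans ?_
  rw [mul_comm 2]
  gcongr

/-- Replacing the Jost solution by the free wave `exp (ikx)` in an integral against `V` costs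
`O(1/k)`. -/
lemma IsJostSolution.norm_integral_sub_le (hf : IsJostSolution b V k f) (hb : 0 ≤ b)
    (hV : IntervalIntegrable V volume 0 b) (hk : 0 ≤ k.im) (hk0 : k ≠ 0)
    (hkV : 2 * (∫ y in (0:ℝ)..b, |V y|) ≤ ‖k‖) {h : ℝ → ℂ} (hh : Continuous h)
    (hh1 : ∀ y, 0 ≤ y → ‖h y * Complex.exp (Complex.I * (k * y))‖ ≤ 1) :
    ‖(∫ y in (0:ℝ)..b, h y * (V y : ℂ) * f y) -
        ∫ y in (0:ℝ)..b, (V y : ℂ) * (h y * Complex.exp (Complex.I * (k * y)))‖ ≤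
      2 * (∫ y in (0:ℝ)..b, |V y|) ^ 2 / ‖k‖ := by
  have hVc : IntervalIntegrable (fun y ↦ (V y : ℂ)) volume 0 b :=
    ⟨hV.1.ofReal, hV.2.ofReal⟩
  have hfc : ContinuousOn f (uIcc 0 b) := by
    rw [uIcc_of_le hb]
    exact hf.1.mono Icc_subset_Ici_self
  rw [← intervalIntegral.integral_sub
    ((hVc.continuousOn_mul hh.continuousOn).mul_continuousOn hfc)
    (hVc.mul_continuousOn (Continuous.continuousOn (by fun_prop)))]
  have hbound := intervalIntegral.norm_integral_le_of_norm_le hb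
    (f := fun y ↦ h y * (V y : ℂ) * f y - (V y : ℂ) * (h y * Complex.exp (Complex.I * (k * y))))
    (ae_of_all _ fun y hy ↦ ?_)
    (hV.abs.mul_const (2 * (∫ y in (0:ℝ)..b, |V y|) / ‖k‖))
  · refine hbound.trans (le_of_eq ?_)
    rw [intervalIntegral.integral_mul_const]
    ring
  · have hfac : h y * (V y : ℂ) * f y - (V y : ℂ) * (h y * Complex.exp (Complex.I * (k * y))) =
        (V y : ℂ) * (h y * Complex.exp (Complex.I * (k * y)) *
          (Complex.exp (-(Complex.I * k * y)) * f y - 1)) := by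
      have : Complex.exp (Complex.I * (k * y)) * Complex.exp (-(Complex.I * k * y)) = 1 := by
        rw [← Complex.exp_add, ← mul_assoc, add_neg_cancel, Complex.exp_zero]
      linear_combination (-(h y * (V y : ℂ) * f y)) * this
    rw [hfac, norm_mul, norm_mul _ (_ - 1), Complex.norm_real, Real.norm_eq_abs]
    gcongr
    exact (mul_le_of_le_one_left (norm_nonneg _) (hh1 y hy.1.le)).trans
      (hf.norm_exp_neg_mul_sub_one_le hV hk hk0 hkV ⟨hy.1.le, hy.2⟩)

end Jost

/-- large-`k` asymptotics of `f(k,0)` and `f'(k,0)` in the closed upper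
half plane: `f(k,0) = 1 - W/(2ik) + o(1/k)` and `f'(k,0) = ik - W/2 + o(1)`. -/
theorem jost_asymptotics_upper (b : ℝ) (hb : 0 < b) (V : ℝ → ℝ) (hV : ClassA b V)
    (f : ℂ → ℝ → ℂ) (hf : ∀ k : ℂ, 0 ≤ k.im → IsJostSolution b V k (f k))
    (W : ℝ) (hW : W = ∫ y in (0:ℝ)..b, V y)
    (f' : ℂ → ℂ)
    (hf' : ∀ k : ℂ, f' k
      = Complex.I * k - ∫ y in (0:ℝ)..b, Complex.cos (k * y) * (V y : ℂ) * f k y) :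
    (∀ ε : ℝ, 0 < ε → ∃ R : ℝ, 0 < R ∧ ∀ k : ℂ, 0 ≤ k.im → R ≤ ‖k‖ →
      ‖k * (f k 0 - 1 + (W : ℂ) / (2 * Complex.I * k))‖ ≤ ε) ∧
    (∀ ε : ℝ, 0 < ε → ∃ R : ℝ, 0 < R ∧ ∀ k : ℂ, 0 ≤ k.im → R ≤ ‖k‖ →
      ‖f' k - Complex.I * k + (W : ℂ) / 2‖ ≤ ε) := by
  have hVi := hV.intervalIntegrable hb.le
  have hVc : IntervalIntegrable (fun y ↦ (V y : ℂ)) volume 0 b :=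
    ⟨hVi.1.ofReal, hVi.2.ofReal⟩
  have hWc : (∫ y in (0:ℝ)..b, (V y : ℂ)) = W := by rw [hW, intervalIntegral.integral_ofReal]
  set C := ∫ y in (0:ℝ)..b, |V y|
  have hC : 0 ≤ C := intervalIntegral.integral_nonneg hb.le fun y _ ↦ abs_nonneg (V y)
  suffices key : ∀ ε : ℝ, 0 < ε → ∃ R : ℝ, 0 < R ∧ ∀ k : ℂ, 0 ≤ k.im → R ≤ ‖k‖ →
      ‖k * (f k 0 - 1 + (W : ℂ) / (2 * Complex.I * k))‖ ≤ ε ∧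
      ‖f' k - Complex.I * k + (W : ℂ) / 2‖ ≤ ε from
    ⟨fun ε hε ↦ (key ε hε).imp fun R h ↦ ⟨h.1, fun k hk hR ↦ (h.2 k hk hR).1⟩,
      fun ε hε ↦ (key ε hε).imp fun R h ↦ ⟨h.1, fun k hk hR ↦ (h.2 k hk hR).2⟩⟩
  intro ε hε
  obtain ⟨R, hR0, hR⟩ := exists_norm_integral_exp_mul_le hb.le hVc hε
  refine ⟨R + 2 * C + 4 * C ^ 2 / ε, by positivity, fun k hk hkR ↦ ?_⟩
  have hCε : 0 ≤ 4 * C ^ 2 / ε := by positivity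
  have hkpos : 0 < ‖k‖ := by linarith
  have hk0 : k ≠ 0 := norm_pos_iff.1 hkpos
  have herr : 2 * C ^ 2 / ‖k‖ ≤ ε / 2 := by
    rw [div_le_iff₀ hkpos]
    have : 4 * C ^ 2 / ε * ε = 4 * C ^ 2 := by field_simp
    nlinarith
  set E := ∫ y in (0:ℝ)..b, (V y : ℂ) * Complex.exp (Complex.I * (2 * k) * y) with hEdef
  have hE : ‖E‖ ≤ ε := by
    refine hR (2 * k) (by simpa using hk) ?_
    rw [norm_mul, Complex.norm_two]
    linarith
  have hEi : IntervalIntegrable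
      (fun y : ℝ ↦ (V y : ℂ) * Complex.exp (Complex.I * (2 * k) * y)) volume 0 b :=
    hVc.mul_continuousOn (Continuous.continuousOn (by fun_prop))
  have hsin : ∫ y in (0:ℝ)..b, (V y : ℂ) *
      (Complex.sin (k * y) * Complex.exp (Complex.I * (k * y))) = (E - W) / (2 * Complex.I) := by
    rw [hEdef, ← hWc, ← intervalIntegral.integral_sub hEi hVc, ← intervalIntegral.integral_div]
    congr 1
    ext y
    rw [sin_mul_exp_I_mul]
    ring_nf
  have hcos : ∫ y in (0:ℝ)..b, (V y : ℂ) *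
      (Complex.cos (k * y) * Complex.exp (Complex.I * (k * y))) = (E + W) / 2 := by
    rw [hEdef, ← hWc, ← intervalIntegral.integral_add hEi hVc, ← intervalIntegral.integral_div]
    congr 1
    ext y
    rw [cos_mul_exp_I_mul]
    ring_nf
  have hS := (hf k hk).norm_integral_sub_le hb.le hVi hk hk0 (by linarith)
    (h := fun y ↦ Complex.sin (k * y)) (by fun_prop)
    (fun y hy ↦ norm_sin_mul_exp_I_mul_le_one hk hy)
  have hT := (hf k hk).norm_integral_sub_le hb.le hVi hk hk0 (by linarith)
    (h := fun y ↦ Complex.cos (k * y)) (by fun_prop)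
    (fun y hy ↦ norm_cos_mul_exp_I_mul_le_one hk hy)
  rw [hsin] at hS
  rw [hcos] at hT
  have hf0 : k * (f k 0 - 1) = ∫ y in (0:ℝ)..b, Complex.sin (k * y) * (V y : ℂ) * f k y := by
    rw [(hf k hk).2.1 0 le_rfl hb.le, Complex.ofReal_zero, mul_zero, Complex.exp_zero,
      add_sub_cancel_left, ← intervalIntegral.integral_const_mul]
    congr 1
    ext y
    rw [jostKernel, if_neg hk0, sub_zero]
    field_simp
  constructor
  · have hid : k * (f k 0 - 1 + (W : ℂ) / (2 * Complex.I * k)) =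
        ((∫ y in (0:ℝ)..b, Complex.sin (k * y) * (V y : ℂ) * f k y) -
          (E - W) / (2 * Complex.I)) + E / (2 * Complex.I) := by
      rw [← hf0]
      field_simp
      ring
    have hE2 : ‖E / (2 * Complex.I)‖ = ‖E‖ / 2 := by simp
    rw [hid]
    refine (norm_add_le _ _).trans ?_
    linarith
  · have hid : f' k - Complex.I * k + (W : ℂ) / 2 =
        -((∫ y in (0:ℝ)..b, Complex.cos (k * y) * (V y : ℂ) * f k y) - (E + W) / 2) - E / 2 := by
      rw [hf' k]
      ring
    have hE2 : ‖E / 2‖ = ‖E‖ / 2 := by simp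
    rw [hid]
    refine (norm_sub_le _ _).trans ?_
    rw [norm_neg]
    linarith
end

section
/- Let k ∈ ℂ, let f₁ : [0,∞) → ℂ be a continuous solution of the Jost integral equation at parameter k, and let f₂ : [0,∞) → ℂ be a continuous solution of the Jost integral equation at parameter −k̄ (the negative of the complex conjugate of k). Then f₂(x) = conj( f₁(x) ) for all x ≥ 0. Consequently, for any real c, the Jost functions F(k) := −i[ f₁'(0) + c f₁(0) ] and F(−k̄) := −i[ f₂'(0) + c f₂(0) ] (with f'(0) := ik − ∫₀^b cos(ky)V(y)f(y)dy at the respective parameter) satisfy F(−k̄) = −conj( F(k) ). -/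
open MeasureTheory Set Filter

lemma conj_jostKernel (k : ℂ) (t : ℝ) :
    starRingEnd ℂ (jostKernel k t) = jostKernel (-(starRingEnd ℂ k)) t := by
  unfold jostKernel
  by_cases hk : k = 0
  · simp [hk]
  · simp [hk, ← Complex.sin_conj]

lemma intervalIntegrable_kernel_mul {K : ℝ → ℂ} (hK : Continuous K) {V : ℝ → ℝ}
    (hV : Integrable V) {d : ℝ → ℂ} {x b : ℝ} (hxb : x ≤ b) (hd : ContinuousOn d (Icc x b)) :
    IntervalIntegrable (fun y => K (y - x) * (V y : ℂ) * d y) volume x b := by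
  have hV' : IntervalIntegrable (fun y => (V y : ℂ)) volume x b := hV.ofReal.intervalIntegrable
  refine (hV'.continuousOn_mul (g := fun y => K (y - x)) ?_).mul_continuousOn ?_
  · exact (by fun_prop : Continuous fun y => K (y - x)).continuousOn
  · rwa [uIcc_of_le hxb]

/-- A homogeneous Volterra equation with continuous kernel and integrable potential has only the
trivial continuous solution. -/
lemma eq_zero_of_volterra {K : ℝ → ℂ} (hK : Continuous K) {V : ℝ → ℝ} (hV : Integrable V)
    {a b : ℝ} {d : ℝ → ℂ} (hd : ContinuousOn d (Icc a b))
    (h : ∀ x ∈ Icc a b, d x = ∫ y in x..b, K (y - x) * (V y : ℂ) * d y) :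
    ∀ x ∈ Icc a b, d x = 0 := by
  by_contra! hne
  set S := {x | x ∈ Icc a b ∧ d x ≠ 0}
  have hSne : S.Nonempty := hne
  have hSb : BddAbove S := ⟨b, fun x hx => hx.1.2⟩
  set x₀ := sSup S
  have hx₀b : x₀ ≤ b := csSup_le hSne fun x hx => hx.1.2
  have hzero : ∀ x, a ≤ x → x₀ < x → x ≤ b → d x = 0 := fun x hax hx hxb => by
    by_contra hdx
    exact absurd (le_csSup hSb (show x ∈ S from ⟨⟨hax, hxb⟩, hdx⟩)) (not_le.2 hx)
  obtain ⟨C, hC⟩ := (isCompact_Icc (a := 0) (b := b - a)).exists_bound_of_continuousOn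
    hK.continuousOn
  have hcont : Continuous fun x => C * ∫ y in x₀..x, |V y| :=
    (intervalIntegral.continuous_primitive (fun _ _ => hV.abs.intervalIntegrable) x₀).const_mul C
  obtain ⟨δ, hδ, hsmall⟩ := Metric.continuous_iff.1 hcont x₀ (1 / 2) (by norm_num)
  obtain ⟨s, hsS, hs⟩ := exists_lt_of_lt_csSup hSne (sub_lt_self x₀ hδ)
  have hsx₀ : s ≤ x₀ := le_csSup hSb hsS
  obtain ⟨m, hm, hmax⟩ := (isCompact_Icc (a := s) (b := x₀)).exists_isMaxOn
    ⟨s, left_mem_Icc.2 hsx₀⟩ (hd.mono (Icc_subset_Icc hsS.1.1 hx₀b)).norm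
  have ham : a ≤ m := hsS.1.1.trans hm.1
  have hdm : ‖d m‖ ≤ (C * ∫ y in m..x₀, |V y|) * ‖d m‖ := by
    have hcut : d m = ∫ y in m..x₀, K (y - m) * (V y : ℂ) * d y := by
      rw [h m ⟨ham, hm.2.trans hx₀b⟩, intervalIntegral.integral_of_le (hm.2.trans hx₀b),
        intervalIntegral.integral_of_le hm.2]
      refine setIntegral_eq_of_subset_of_forall_sdiff_eq_zero measurableSet_Ioc
        (Ioc_subset_Ioc_right hx₀b) fun y hy => ?_
      rw [hzero y (ham.trans hy.1.1.le) (not_le.1 fun hle => hy.2 ⟨hy.1.1, hle⟩) hy.1.2, mul_zero]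
    calc ‖d m‖ = ‖∫ y in m..x₀, K (y - m) * (V y : ℂ) * d y‖ := congrArg _ hcut
      _ ≤ ∫ y in m..x₀, C * |V y| * ‖d m‖ := by
        refine intervalIntegral.norm_integral_le_of_norm_le hm.2
          (ae_of_all _ fun y hy => ?_)
          ((hV.abs.const_mul C).mul_const ‖d m‖).intervalIntegrable
        have hKy : ‖K (y - m)‖ ≤ C :=
          hC _ ⟨sub_nonneg.2 hy.1.le, sub_le_sub (hy.2.trans hx₀b) ham⟩
        have hdy : ‖d y‖ ≤ ‖d m‖ := hmax ⟨hm.1.trans hy.1.le, hy.2⟩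
        rw [norm_mul, norm_mul, Complex.norm_real, Real.norm_eq_abs]
        have hC0 : 0 ≤ C := (norm_nonneg _).trans hKy
        gcongr
      _ = (C * ∫ y in m..x₀, |V y|) * ‖d m‖ := by
        rw [intervalIntegral.integral_mul_const, intervalIntegral.integral_const_mul]
  have hhalf : C * ∫ y in m..x₀, |V y| ≤ 1 / 2 := by
    have hdist := hsmall m (by
      rw [Real.dist_eq, abs_sub_lt_iff]
      constructor <;> linarith [hm.1, hm.2])
    rw [Real.dist_eq, intervalIntegral.integral_same, mul_zero, sub_zero,
      intervalIntegral.integral_symm, mul_neg, abs_neg] at hdist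
    exact (le_abs_self _).trans hdist.le
  have hds : ‖d s‖ ≤ ‖d m‖ := hmax (left_mem_Icc.2 hsx₀)
  have hpos : 0 < ‖d s‖ := norm_pos_iff.2 hsS.2
  nlinarith

lemma IsJostSolution.conj {b : ℝ} {V : ℝ → ℝ} {k : ℂ} {f : ℝ → ℂ} (hf : IsJostSolution b V k f) :
    IsJostSolution b V (-(starRingEnd ℂ k)) fun x => starRingEnd ℂ (f x) := by
  refine ⟨Complex.continuous_conj.comp_continuousOn hf.1, fun x hx hxb => ?_, fun x hx => ?_⟩
  · beta_reduce
    rw [hf.2.1 x hx hxb, map_add, ← Complex.exp_conj, ← intervalIntegral.intervalIntegral_conj]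
    simp [conj_jostKernel]
  · beta_reduce
    rw [hf.2.2 x hx, ← Complex.exp_conj]
    simp

lemma IsJostSolution.unique {b : ℝ} {V : ℝ → ℝ} (hV : Integrable V) {k : ℂ} {f g : ℝ → ℂ}
    (hf : IsJostSolution b V k f) (hg : IsJostSolution b V k g) {x : ℝ} (hx : 0 ≤ x) :
    f x = g x := by
  rcases le_total b x with hbx | hxb
  · rw [hf.2.2 x hbx, hg.2.2 x hbx]
  refine sub_eq_zero.1 (eq_zero_of_volterra (continuous_jostKernel k) hV (a := 0) (b := b)
    (d := fun y => f y - g y) ((hf.1.sub hg.1).mono Icc_subset_Ici_self) (fun y hy => ?_) x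
    ⟨hx, hxb⟩)
  have hsub : Icc y b ⊆ Ici 0 := fun z hz => hy.1.trans hz.1
  have hK := continuous_jostKernel k
  simp only [mul_sub]
  rw [intervalIntegral.integral_sub
    (intervalIntegrable_kernel_mul hK hV hy.2 (hf.1.mono hsub))
    (intervalIntegrable_kernel_mul hK hV hy.2 (hg.1.mono hsub)),
    hf.2.1 y hy.1 hy.2, hg.2.1 y hy.1 hy.2]
  ring

/-- conjugation symmetry: the Jost solution at `-k̄` is the complex
conjugate of the Jost solution at `k`, and consequently `F(-k̄) = -conj(F(k))`. -/
theorem jost_conjugation_symmetry (b : ℝ) (hb : 0 < b) (V : ℝ → ℝ) (hV : ClassA b V)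
    (k : ℂ)
    (f₁ : ℝ → ℂ) (hf₁ : IsJostSolution b V k f₁)
    (f₂ : ℝ → ℂ) (hf₂ : IsJostSolution b V (-(starRingEnd ℂ k)) f₂)
    (c : ℝ) (F₁ F₂ : ℂ)
    (hF₁ : F₁ = -Complex.I *
      ((Complex.I * k - ∫ y in (0:ℝ)..b, Complex.cos (k * y) * (V y : ℂ) * f₁ y)
        + (c : ℂ) * f₁ 0))
    (hF₂ : F₂ = -Complex.I *
      ((Complex.I * (-(starRingEnd ℂ k))
          - ∫ y in (0:ℝ)..b, Complex.cos ((-(starRingEnd ℂ k)) * y) * (V y : ℂ) * f₂ y)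
        + (c : ℂ) * f₂ 0)) :
    (∀ x : ℝ, 0 ≤ x → f₂ x = starRingEnd ℂ (f₁ x)) ∧
    F₂ = -starRingEnd ℂ F₁ := by
  have hconj : ∀ x : ℝ, 0 ≤ x → f₂ x = starRingEnd ℂ (f₁ x) := fun x hx =>
    hf₂.unique hV.integrable hf₁.conj hx
  refine ⟨hconj, ?_⟩
  have hint : ∫ y in (0:ℝ)..b, Complex.cos ((-(starRingEnd ℂ k)) * y) * (V y : ℂ) * f₂ y =
      starRingEnd ℂ (∫ y in (0:ℝ)..b, Complex.cos (k * y) * (V y : ℂ) * f₁ y) := by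
    rw [← intervalIntegral.intervalIntegral_conj]
    refine intervalIntegral.integral_congr fun y hy => ?_
    rw [uIcc_of_le hb.le] at hy
    simp [hconj y hy.1, ← Complex.cos_conj]
  rw [hF₂, hF₁, hint, hconj 0 le_rfl]
  simp only [map_mul, map_neg, map_add, map_sub, Complex.conj_I, Complex.conj_ofReal]
  ring
end

section
/- Let c ∈ ℝ and k ∈ ℂ with k ≠ 0. Let f₊ be a continuous solution of the Jost integral equation at parameter k and f₋ a continuous solution at parameter −k, with derivatives at 0 defined by f₊'(0) := ik − ∫₀^b cos(ky)V(y)f₊(y)dy and f₋'(0) := −ik − ∫₀^b cos(ky)V(y)f₋(y)dy, and define the Jost function values F(k) := −i[ f₊'(0) + c f₊(0) ] and F(−k) := −i[ f₋'(0) + c f₋(0) ]. Then F(k) and F(−k) do not both vanish: ¬( F(k) = 0 ∧ F(−k) = 0 ). -/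
open MeasureTheory Set Filter

/-- Splitting a product of two integrals over a square into the two triangles. -/
theorem integral_mul_integral_eq_add_triangles {b : ℝ} (hb : 0 ≤ b) {G H : ℝ → ℂ}
    (hG : IntervalIntegrable G volume 0 b) (hH : IntervalIntegrable H volume 0 b) :
    (∫ x in (0:ℝ)..b, G x) * (∫ x in (0:ℝ)..b, H x) =
      (∫ x in (0:ℝ)..b, G x * ∫ y in x..b, H y) + ∫ x in (0:ℝ)..b, H x * ∫ y in x..b, G y := by
  rw [intervalIntegrable_iff_integrableOn_Ioc_of_le hb, IntegrableOn] at hG hH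
  simp only [intervalIntegral.integral_of_le hb]
  set μ := volume.restrict (Ioc 0 b) with hμ
  have tail : ∀ (F : ℝ → ℂ) (x : ℝ), x ∈ Ioc 0 b →
      ∫ y in x..b, F y = ∫ y, (Ioi x).indicator F y ∂μ := by
    intro F x hx
    rw [intervalIntegral.integral_of_le hx.2, integral_indicator measurableSet_Ioi, hμ,
      Measure.restrict_restrict measurableSet_Ioi]
    congr 2
    ext y
    simp only [mem_inter_iff, mem_Ioi, mem_Ioc]
    grind
  have hGH : Integrable (fun z : ℝ × ℝ => G z.1 * H z.2) (μ.prod μ) := hG.mul_prod hH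
  have hS : MeasurableSet {z : ℝ × ℝ | z.1 < z.2} := measurableSet_lt measurable_fst measurable_snd
  have below : ∫ z in {z : ℝ × ℝ | z.1 < z.2}, G z.1 * H z.2 ∂(μ.prod μ) =
      ∫ x, G x * (∫ y in x..b, H y) ∂μ := by
    rw [← integral_indicator hS, integral_prod _ (hGH.indicator hS)]
    refine setIntegral_congr_fun measurableSet_Ioc fun x hx => ?_
    simp only [tail H x hx, ← integral_const_mul]
    refine integral_congr_ae (ae_of_all _ fun y => ?_)
    by_cases h : x < y <;> simp [indicator, h]
  have above : ∫ z in {z : ℝ × ℝ | z.1 < z.2}ᶜ, G z.1 * H z.2 ∂(μ.prod μ) =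
      ∫ y, H y * (∫ x in y..b, G x) ∂μ := by
    rw [← integral_indicator hS.compl, integral_prod_symm _ (hGH.indicator hS.compl)]
    refine setIntegral_congr_fun measurableSet_Ioc fun y hy => ?_
    simp only [tail G y hy, ← integral_const_mul]
    refine integral_congr_ae ?_
    filter_upwards [compl_mem_ae_iff.mpr (measure_singleton (μ := μ) y)] with x hxy
    have hxy : x ≠ y := hxy
    by_cases h : x < y
    · simp [indicator, h, h.le]
    · have : y < x := lt_of_le_of_ne (not_lt.mp h) hxy.symm
      simp [indicator, h, this, mul_comm]
  rw [← below, ← above, integral_add_compl hS hGH, integral_prod_mul]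

theorem two_I_mul_jostKernel {k : ℂ} (hk : k ≠ 0) (x y : ℝ) :
    2 * Complex.I * k * jostKernel k (y - x) =
      Complex.exp (-(Complex.I * k * x)) * Complex.exp (Complex.I * k * y) -
        Complex.exp (Complex.I * k * x) * Complex.exp (-(Complex.I * k * y)) := by
  rw [jostKernel, if_neg hk, ← Complex.exp_add, ← Complex.exp_add, Complex.sin]
  rw [show -(Complex.I * k * x) + Complex.I * k * y = k * ((y - x : ℝ) : ℂ) * Complex.I by
      push_cast; ring,
    show Complex.I * k * x + -(Complex.I * k * y) = -(k * ((y - x : ℝ) : ℂ)) * Complex.I by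
      push_cast; ring]
  generalize Complex.exp (k * ((y - x : ℝ) : ℂ) * Complex.I) = u
  generalize Complex.exp (-(k * ((y - x : ℝ) : ℂ)) * Complex.I) = v
  field_simp
  linear_combination (v - u) * Complex.I_sq

theorem jostKernel_neg (k : ℂ) (t : ℝ) : jostKernel (-k) t = jostKernel k t := by
  simp [jostKernel]

/-- The convolution term in the Jost equation, decomposed into exponentials. -/
theorem two_I_mul_integral_jostKernel {k : ℂ} (hk : k ≠ 0) {g : ℝ → ℂ} {x b : ℝ}
    (hg : IntervalIntegrable g volume x b) :
    2 * Complex.I * k * ∫ y in x..b, jostKernel k (y - x) * g y =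
      Complex.exp (-(Complex.I * k * x)) * (∫ y in x..b, Complex.exp (Complex.I * k * y) * g y) -
        Complex.exp (Complex.I * k * x) *
          ∫ y in x..b, Complex.exp (-(Complex.I * k * y)) * g y := by
  simp only [← intervalIntegral.integral_const_mul]
  rw [← intervalIntegral.integral_sub]
  · refine intervalIntegral.integral_congr fun y _ => ?_
    linear_combination g y * two_I_mul_jostKernel hk x y
  · exact (hg.continuousOn_mul (by fun_prop)).const_mul _
  · exact (hg.continuousOn_mul (by fun_prop)).const_mul _

theorem two_mul_integral_cos {k : ℂ} {g : ℝ → ℂ} {b : ℝ}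
    (hg : IntervalIntegrable g volume 0 b) :
    2 * ∫ y in (0:ℝ)..b, Complex.cos (k * y) * g y =
      (∫ y in (0:ℝ)..b, Complex.exp (Complex.I * k * y) * g y) +
        ∫ y in (0:ℝ)..b, Complex.exp (-(Complex.I * k * y)) * g y := by
  rw [← intervalIntegral.integral_const_mul, ← intervalIntegral.integral_add]
  · refine intervalIntegral.integral_congr fun y _ => ?_
    simp only [Complex.cos]
    rw [show k * y * Complex.I = Complex.I * k * y by ring,
      show -(k * (y : ℂ)) * Complex.I = -(Complex.I * k * y) by ring]
    ring
  · exact hg.continuousOn_mul (by fun_prop)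
  · exact hg.continuousOn_mul (by fun_prop)

theorem ClassA.intervalIntegrable_mul {b : ℝ} {V : ℝ → ℝ} (hV : ClassA b V) (hb : 0 ≤ b)
    {f : ℝ → ℂ} (hf : ContinuousOn f (Ici 0)) :
    IntervalIntegrable (fun y => (V y : ℂ) * f y) volume 0 b := by
  have h : IntervalIntegrable (fun y => (V y : ℂ)) volume 0 b := by
    rw [intervalIntegrable_iff_integrableOn_Ioo_of_le hb]
    exact hV.2.1.ofReal
  refine h.mul_continuousOn (hf.mono ?_)
  rw [uIcc_of_le hb]
  exact Icc_subset_Ici_self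

/-- for `k ≠ 0`, the Jost function values `F(k)` and `F(-k)` cannot
vanish simultaneously. -/
theorem jost_function_not_both_zero (b : ℝ) (hb : 0 < b) (V : ℝ → ℝ) (hV : ClassA b V)
    (c : ℝ) (k : ℂ) (hk : k ≠ 0)
    (fp : ℝ → ℂ) (hfp : IsJostSolution b V k fp)
    (fm : ℝ → ℂ) (hfm : IsJostSolution b V (-k) fm)
    (Fp Fm : ℂ)
    (hFp : Fp = -Complex.I *
      ((Complex.I * k - ∫ y in (0:ℝ)..b, Complex.cos (k * y) * (V y : ℂ) * fp y)
        + (c : ℂ) * fp 0))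
    (hFm : Fm = -Complex.I *
      ((-Complex.I * k - ∫ y in (0:ℝ)..b, Complex.cos (k * y) * (V y : ℂ) * fm y)
        + (c : ℂ) * fm 0)) :
    ¬(Fp = 0 ∧ Fm = 0) := by
  rintro ⟨hp, hm⟩
  have hgi := hV.intervalIntegrable_mul hb.le hfp.1
  have hhi := hV.intervalIntegrable_mul hb.le hfm.1
  set g : ℝ → ℂ := fun y => (V y : ℂ) * fp y with hg
  set h : ℝ → ℂ := fun y => (V y : ℂ) * fm y with hh
  have tail_int : ∀ {F : ℝ → ℂ}, IntervalIntegrable F volume 0 b → ∀ x, 0 ≤ x → x ≤ b →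
      IntervalIntegrable F volume x b := fun hF x h0 hx =>
    hF.mono_set (by rw [uIcc_of_le hx, uIcc_of_le hb.le]; exact Icc_subset_Icc_left h0)
  set E : ℝ → ℂ := fun y => Complex.exp (Complex.I * k * y) with hE
  set E' : ℝ → ℂ := fun y => Complex.exp (-(Complex.I * k * y)) with hE'
  have hEc : Continuous E := by fun_prop
  have hEc' : Continuous E' := by fun_prop
  have hfp_eq : ∀ x, 0 ≤ x → x ≤ b → 2 * Complex.I * k * (fp x - E x) =
      E' x * (∫ y in x..b, E y * g y) - E x * ∫ y in x..b, E' y * g y := by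
    intro x h0 hx
    rw [← two_I_mul_integral_jostKernel hk (tail_int hgi x h0 hx), hfp.2.1 x h0 hx]
    simp only [hg, hE, mul_assoc, add_sub_cancel_left]
  have hfm_eq : ∀ x, 0 ≤ x → x ≤ b → 2 * Complex.I * k * (fm x - E' x) =
      E' x * (∫ y in x..b, E y * h y) - E x * ∫ y in x..b, E' y * h y := by
    intro x h0 hx
    rw [← two_I_mul_integral_jostKernel hk (tail_int hhi x h0 hx), hfm.2.1 x h0 hx]
    simp only [hh, hE', mul_assoc, jostKernel_neg, neg_mul, mul_neg, add_sub_cancel_left]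
  have hEg : IntervalIntegrable (fun y => E y * g y) volume 0 b :=
    hgi.continuousOn_mul hEc.continuousOn
  have hEh : IntervalIntegrable (fun y => E y * h y) volume 0 b :=
    hhi.continuousOn_mul hEc.continuousOn
  have hEg' : IntervalIntegrable (fun y => E' y * g y) volume 0 b :=
    hgi.continuousOn_mul hEc'.continuousOn
  have hEh' : IntervalIntegrable (fun y => E' y * h y) volume 0 b :=
    hhi.continuousOn_mul hEc'.continuousOn
  have tail_mul : ∀ {A B : ℝ → ℂ}, IntervalIntegrable A volume 0 b →
      IntervalIntegrable B volume 0 b →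
      IntervalIntegrable (fun x => A x * ∫ y in x..b, B y) volume 0 b := by
    intro A B hA hB
    refine hA.mul_continuousOn ?_
    refine intervalIntegral.continuousOn_primitive_interval_left ?_
    rwa [uIcc_of_le hb.le, ← intervalIntegrable_iff_integrableOn_Icc_of_le hb.le]
  have wronskian : (∫ y in (0:ℝ)..b, E y * g y) * (∫ y in (0:ℝ)..b, E' y * h y) -
      (∫ y in (0:ℝ)..b, E' y * g y) * (∫ y in (0:ℝ)..b, E y * h y) =
      2 * Complex.I * k * ((∫ y in (0:ℝ)..b, E' y * g y) - ∫ y in (0:ℝ)..b, E y * h y) := by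
    rw [integral_mul_integral_eq_add_triangles hb.le hEg hEh',
      integral_mul_integral_eq_add_triangles hb.le hEg' hEh,
      ← intervalIntegral.integral_add (tail_mul hEg hEh') (tail_mul hEh' hEg),
      ← intervalIntegral.integral_add (tail_mul hEg' hEh) (tail_mul hEh hEg'),
      ← intervalIntegral.integral_sub
        ((tail_mul hEg hEh').add (tail_mul hEh' hEg))
        ((tail_mul hEg' hEh).add (tail_mul hEh hEg')),
      ← intervalIntegral.integral_sub hEg' hEh, ← intervalIntegral.integral_const_mul]
    refine intervalIntegral.integral_congr fun x hx => ?_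
    rw [uIcc_of_le hb.le] at hx
    have hcross : g x * fm x = h x * fp x := by simp only [hg, hh]; ring
    linear_combination h x * (-hfp_eq x hx.1 hx.2) + g x * hfm_eq x hx.1 hx.2
      - 2 * Complex.I * k * hcross
  have hp0 := hfp_eq 0 le_rfl hb.le
  have hm0 := hfm_eq 0 le_rfl hb.le
  have hcp := two_mul_integral_cos (k := k) hgi
  have hcm := two_mul_integral_cos (k := k) hhi
  simp only [hE, hE', Complex.ofReal_zero, mul_zero, neg_zero, Complex.exp_zero, one_mul]
    at hp0 hm0 hcp hcm wronskian
  simp only [mul_assoc] at hFp hFm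
  rw [hFp] at hp
  rw [hFm] at hm
  have hp := (mul_eq_zero.mp hp).resolve_left (neg_ne_zero.mpr Complex.I_ne_zero)
  have hm := (mul_eq_zero.mp hm).resolve_left (neg_ne_zero.mpr Complex.I_ne_zero)
  simp only [hg, hh] at hp0 hm0 hcp hcm wronskian
  generalize (∫ y in (0:ℝ)..b, Complex.exp (Complex.I * k * y) * ((V y : ℂ) * fp y)) = Q at *
  generalize (∫ y in (0:ℝ)..b, Complex.exp (-(Complex.I * k * y)) * ((V y : ℂ) * fp y)) = P at *
  generalize (∫ y in (0:ℝ)..b, Complex.exp (Complex.I * k * y) * ((V y : ℂ) * fm y)) = Q' at *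
  generalize (∫ y in (0:ℝ)..b, Complex.exp (-(Complex.I * k * y)) * ((V y : ℂ) * fm y)) = P' at *
  generalize (∫ y in (0:ℝ)..b, Complex.cos (k * y) * ((V y : ℂ) * fp y)) = C at *
  generalize (∫ y in (0:ℝ)..b, Complex.cos (k * y) * ((V y : ℂ) * fm y)) = C' at *
  obtain ⟨z, hz⟩ : ∃ z, z = 2 * Complex.I * k := ⟨_, rfl⟩
  rw [← hz] at hp0 hm0 wronskian
  have hz0 : z ≠ 0 := by simp [hz, hk]
  have hfp0 : z * fp 0 = z + Q - P := by linear_combination hp0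
  have hfm0 : z * fm 0 = z + Q' - P' := by linear_combination hm0
  have hdp : z - Q - P + 2 * c * fp 0 = 0 := by linear_combination 2 * hp + hcp + hz
  have hdm : -z - Q' - P' + 2 * c * fm 0 = 0 := by linear_combination 2 * hm + hcm - hz
  have hsq : z ^ 2 = 0 := by
    linear_combination (z * fm 0 * hdp - z * fp 0 * hdm - (z - Q - P) * hfm0
      + (-z - Q' - P') * hfp0) / 2 - wronskian
  exact hz0 (pow_eq_zero_iff two_ne_zero |>.mp hsq)
end

section
/- Let c ∈ ℝ and let F : ℂ → ℂ be entire such that: for every k ≠ 0, F(k) and F(−k) do not both vanish; and if F(0) = 0 then F'(0) ≠ 0. Let D : ℂ → ℂ be a continuous function with D(k) = (1/(2ik))·[ (k − ic)·F(−k) − (−k − ic)·F(k) ] for all k ≠ 0. Then: (a) if D(k₀) = 0 and F(k₀) = 0 for some k₀ ∈ ℂ, then k₀ = ic; and (b) F(ic) = 0 if and only if D(ic) = 0. -/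
open Filter Topology in
/-- The value at the origin of the continuous extension of
`k ↦ (2ik)⁻¹ ((k - a) F(-k) - (-k - a) F(k))`. -/
theorem two_I_mul_apply_zero_of_continuousAt {F D : ℂ → ℂ} (a : ℂ) (hF : DifferentiableAt ℂ F 0)
    (hDc : ContinuousAt D 0)
    (hD : ∀ k : ℂ, k ≠ 0 → D k = (1 / (2 * Complex.I * k))
      * ((k - a) * F (-k) - (-k - a) * F k)) :
    2 * Complex.I * D 0 = 2 * F 0 + 2 * a * deriv F 0 := by
  have hF0 : HasDerivAt F (deriv F 0) 0 := hF.hasDerivAt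
  have hFneg : HasDerivAt (fun k : ℂ => F (-k)) (-deriv F 0) 0 := by
    have h : HasDerivAt F (deriv F 0) (-0) := by simpa using hF0
    simpa [Function.comp_def] using! h.comp (0 : ℂ) (hasDerivAt_neg (0 : ℂ))
  have hg : HasDerivAt (fun k : ℂ => (k - a) * F (-k) - (-k - a) * F k)
      (2 * F 0 + 2 * a * deriv F 0) 0 := by
    refine ((((hasDerivAt_id (0 : ℂ)).sub_const a).mul hFneg).sub
      (((hasDerivAt_neg (0 : ℂ)).sub_const a).mul hF0)).congr_deriv ?_
    simp only [id, neg_zero]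
    ring
  have hslope := hasDerivAt_iff_tendsto_slope_zero.mp hg
  have hlim : Tendsto (fun k => 2 * Complex.I * D k) (𝓝[≠] 0) (𝓝 (2 * Complex.I * D 0)) :=
    (hDc.tendsto.const_mul _).mono_left nhdsWithin_le_nhds
  refine tendsto_nhds_unique (hlim.congr' ?_) hslope
  filter_upwards [self_mem_nhdsWithin] with k hk
  have hk : k ≠ 0 := hk
  rw [hD k hk]
  simp only [zero_add, neg_zero, smul_eq_mul]
  field_simp
  ring

/-- `D` and `F` can only vanish simultaneously at `k = ic`, and
`F(ic) = 0 ↔ D(ic) = 0`. -/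
theorem D_and_F_simultaneous_zeros (c : ℝ) (F : ℂ → ℂ)
    (hF : Differentiable ℂ F)
    (hnb : ∀ k : ℂ, k ≠ 0 → ¬(F k = 0 ∧ F (-k) = 0))
    (hsimple : F 0 = 0 → deriv F 0 ≠ 0)
    (D : ℂ → ℂ) (hDc : Continuous D)
    (hD : ∀ k : ℂ, k ≠ 0 → D k = (1 / (2 * Complex.I * k))
      * ((k - Complex.I * (c : ℂ)) * F (-k) - (-k - Complex.I * (c : ℂ)) * F k)) :
    (∀ k₀ : ℂ, D k₀ = 0 → F k₀ = 0 → k₀ = Complex.I * (c : ℂ)) ∧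
    (F (Complex.I * (c : ℂ)) = 0 ↔ D (Complex.I * (c : ℂ)) = 0) := by
  have hD0 := two_I_mul_apply_zero_of_continuousAt (Complex.I * (c : ℂ)) hF.differentiableAt
    hDc.continuousAt hD
  refine ⟨fun k₀ hDk hFk => ?_, ?_⟩
  · rcases eq_or_ne k₀ 0 with rfl | hk
    · have h : Complex.I * (c : ℂ) * deriv F 0 = 0 := by
        rw [hDk, hFk] at hD0
        linear_combination -hD0 / 2
      exact ((mul_eq_zero.mp h).resolve_right (hsimple hFk)).symm
    · have hFneg : F (-k₀) ≠ 0 := fun h => hnb k₀ hk ⟨hFk, h⟩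
      rw [hD k₀ hk, hFk] at hDk
      simpa [hk, hFneg, sub_eq_zero] using hDk
  · rcases eq_or_ne (Complex.I * (c : ℂ)) 0 with h0 | h0
    · rw [h0] at hD0 ⊢
      have h : F 0 = Complex.I * D 0 := by linear_combination -hD0 / 2
      simp [h]
    · have h : F (Complex.I * c) = Complex.I * D (Complex.I * c) := by
        have hc : (c : ℂ) ≠ 0 := right_ne_zero_of_mul h0
        rw [hD _ h0]
        field_simp
        ring
      simp [h]
end

section
/- Let b > 0 and W, c ∈ ℝ, and let F : ℂ → ℂ satisfy: F(k) − k − i(W/2 − c) → 0 as k → ∞ in the closed upper half plane {Im k ≥ 0}, and e^{−2ikb}·( F(k) − k − i(W/2 − c) ) → 0 as k → ∞ in the closed lower half plane {Im k ≤ 0}. Define D(k) := (1/(2i))·( F(k) + F(−k) ) + (c/(2k))·( F(k) − F(−k) ) for k ≠ 0. Then e^{−2b·|Im k|}·( D(k) − W/2 ) → 0 as k → ∞ in ℂ; that is, for every ε > 0 there is R > 0 with |D(k) − W/2| ≤ ε·e^{2b·|Im k|} whenever |k| ≥ R. -/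
/-- Half-plane asymptotics for `G`, with an exponential weight in the lower half plane,
combine into a bound by `ε e^{2b|Im k|}` in the whole plane. -/
theorem norm_le_mul_exp_abs_im_of_half_planes (b : ℝ) (hb : 0 ≤ b) (G : ℂ → ℂ)
    (hup : ∀ ε : ℝ, 0 < ε → ∃ R : ℝ, 0 < R ∧ ∀ k : ℂ, 0 ≤ k.im → R ≤ ‖k‖ → ‖G k‖ ≤ ε)
    (hlo : ∀ ε : ℝ, 0 < ε → ∃ R : ℝ, 0 < R ∧ ∀ k : ℂ, k.im ≤ 0 → R ≤ ‖k‖ →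
      ‖Complex.exp (-2 * Complex.I * k * b) * G k‖ ≤ ε) (ε : ℝ) (hε : 0 < ε) :
    ∃ R : ℝ, 0 < R ∧ ∀ k : ℂ, R ≤ ‖k‖ → ‖G k‖ ≤ ε * Real.exp (2 * b * |k.im|) := by
  obtain ⟨R₁, hR₁, h₁⟩ := hup ε hε
  obtain ⟨R₂, -, h₂⟩ := hlo ε hε
  refine ⟨max R₁ R₂, lt_max_of_lt_left hR₁, fun k hk ↦ ?_⟩
  rcases le_total 0 k.im with h | h
  · exact (h₁ k h ((le_max_left _ _).trans hk)).trans
      (le_mul_of_one_le_right hε.le (Real.one_le_exp (by positivity)))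
  · have hG := h₂ k h ((le_max_right _ _).trans hk)
    have hre : (-2 * Complex.I * k * b).re = -(2 * b * |k.im|) := by
      rw [abs_of_nonpos h]
      simp
      ring
    rw [norm_mul, Complex.norm_exp, hre, Real.exp_neg] at hG
    rwa [inv_mul_le_iff₀ (Real.exp_pos _), mul_comm] at hG


/-- the large-`k` asymptotics `D(k) - W/2 = e^{2b|Im k|}·o(1)` as
`k → ∞` in `ℂ`, given the Jost-function asymptotics in both half planes. -/
theorem D_asymptotics_in_plane (b : ℝ) (hb : 0 < b) (W c : ℝ) (F : ℂ → ℂ)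
    (hup : ∀ ε : ℝ, 0 < ε → ∃ R : ℝ, 0 < R ∧ ∀ k : ℂ, 0 ≤ k.im → R ≤ ‖k‖ →
      ‖F k - k - Complex.I * ((W : ℂ) / 2 - (c : ℂ))‖ ≤ ε)
    (hlo : ∀ ε : ℝ, 0 < ε → ∃ R : ℝ, 0 < R ∧ ∀ k : ℂ, k.im ≤ 0 → R ≤ ‖k‖ →
      ‖Complex.exp (-2 * Complex.I * k * b)
        * (F k - k - Complex.I * ((W : ℂ) / 2 - (c : ℂ)))‖ ≤ ε)
    (D : ℂ → ℂ)
    (hD : ∀ k : ℂ, k ≠ 0 → D k = (1 / (2 * Complex.I)) * (F k + F (-k))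
      + ((c : ℂ) / (2 * k)) * (F k - F (-k))) :
    ∀ ε : ℝ, 0 < ε → ∃ R : ℝ, 0 < R ∧ ∀ k : ℂ, R ≤ ‖k‖ →
      ‖D k - (W : ℂ) / 2‖ ≤ ε * Real.exp (2 * b * |k.im|) := by
  intro ε hε
  set G : ℂ → ℂ := fun k ↦ F k - k - Complex.I * ((W : ℂ) / 2 - (c : ℂ)) with hG
  obtain ⟨R, hR, h⟩ :=
    norm_le_mul_exp_abs_im_of_half_planes b hb.le G hup hlo (ε / 2) (half_pos hε)
  refine ⟨max R |c|, lt_max_of_lt_left hR, fun k hk ↦ ?_⟩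
  have hRk : R ≤ ‖k‖ := (le_max_left _ _).trans hk
  have hck : |c| ≤ ‖k‖ := (le_max_right _ _).trans hk
  have hk_pos : 0 < ‖k‖ := hR.trans_le hRk
  have hk0 : k ≠ 0 := norm_pos_iff.mp hk_pos
  have hGk := h k hRk
  have hGnk := h (-k) (by rwa [norm_neg])
  rw [Complex.neg_im, abs_neg] at hGnk
  have hDG : D k - (W : ℂ) / 2
      = (1 / (2 * Complex.I)) * (G k + G (-k)) + ((c : ℂ) / (2 * k)) * (G k - G (-k)) := by
    rw [hD k hk0]
    simp only [hG]
    field_simp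
    ring
  have hsum : ‖(1 / (2 * Complex.I)) * (G k + G (-k))‖ ≤ 1 / 2 * (‖G k‖ + ‖G (-k)‖) := by
    rw [norm_mul]
    gcongr
    · simp
    · exact norm_add_le _ _
  have hcoef : ‖(c : ℂ) / (2 * k)‖ ≤ 1 / 2 := by
    rw [norm_div, norm_mul, Complex.norm_real, Real.norm_eq_abs, Complex.norm_ofNat,
      div_le_iff₀ (by positivity)]
    linarith
  have hdiff : ‖((c : ℂ) / (2 * k)) * (G k - G (-k))‖ ≤ 1 / 2 * (‖G k‖ + ‖G (-k)‖) := by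
    rw [norm_mul]
    gcongr
    exact norm_sub_le _ _
  rw [hDG]
  linarith [norm_add_le ((1 / (2 * Complex.I)) * (G k + G (-k)))
    (((c : ℂ) / (2 * k)) * (G k - G (-k)))]
end

section
/- Let g : ℝ → ℂ be continuous and even (g(−t) = g(t) for all t), with g(t) → 0 as t → +∞. Then for every k ∈ ℂ with Im k > 0, the function t ↦ g(t)/(t² − k²) is integrable on (0,∞), and the symmetric limit lim_{R→∞} ∫_{−R}^{R} g(t)/(t − k) dt exists and equals 2k·∫₀^∞ g(t)/(t² − k²) dt. -/
open MeasureTheory Filter Set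

lemma ofReal_sub_ne_zero_of_im_pos {k : ℂ} (hk : 0 < k.im) (t : ℝ) : (t : ℂ) - k ≠ 0 := by
  intro h
  simpa [hk.ne'] using congrArg Complex.im h

lemma ofReal_add_ne_zero_of_im_pos {k : ℂ} (hk : 0 < k.im) (t : ℝ) : (t : ℂ) + k ≠ 0 := by
  intro h
  simpa [hk.ne'] using congrArg Complex.im h

lemma ofReal_sq_sub_sq_ne_zero_of_im_pos {k : ℂ} (hk : 0 < k.im) (t : ℝ) :
    (t : ℂ) ^ 2 - k ^ 2 ≠ 0 := by
  rw [sq_sub_sq]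
  exact mul_ne_zero (ofReal_add_ne_zero_of_im_pos hk t) (ofReal_sub_ne_zero_of_im_pos hk t)

lemma isBigO_inv_ofReal_sq_sub_sq (k : ℂ) :
    (fun t : ℝ => ((t : ℂ) ^ 2 - k ^ 2)⁻¹) =O[atTop] fun t : ℝ => (1 + t ^ 2)⁻¹ := by
  refine Asymptotics.IsBigO.of_bound 2 ?_
  filter_upwards [eventually_ge_atTop (2 * ‖k‖ ^ 2 + 1)] with t ht
  have hlower : (1 + t ^ 2) / 2 ≤ ‖(t : ℂ) ^ 2 - k ^ 2‖ := by
    have h := norm_sub_norm_le ((t : ℂ) ^ 2) (k ^ 2)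
    simp only [norm_pow, Complex.norm_real, Real.norm_eq_abs, sq_abs] at h
    nlinarith [sq_nonneg ‖k‖]
  rw [norm_inv, norm_inv, Real.norm_of_nonneg (by positivity : (0 : ℝ) ≤ 1 + t ^ 2)]
  calc ‖(t : ℂ) ^ 2 - k ^ 2‖⁻¹ ≤ ((1 + t ^ 2) / 2)⁻¹ := inv_anti₀ (by positivity) hlower
    _ = 2 * (1 + t ^ 2)⁻¹ := by rw [inv_div, div_eq_mul_inv]

lemma integrableOn_Ioi_div_ofReal_sq_sub_sq {g : ℝ → ℂ} (hg : Continuous g)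
    (hlim : Tendsto g atTop (nhds 0)) {k : ℂ} (hk : 0 < k.im) (a : ℝ) :
    IntegrableOn (fun t : ℝ => g t / ((t : ℂ) ^ 2 - k ^ 2)) (Ioi a) := by
  have hcont : Continuous fun t : ℝ => g t / ((t : ℂ) ^ 2 - k ^ 2) :=
    hg.div (by fun_prop) (ofReal_sq_sub_sq_ne_zero_of_im_pos hk)
  have hO : (fun t : ℝ => g t / ((t : ℂ) ^ 2 - k ^ 2)) =O[atTop]
      fun t : ℝ => (1 + t ^ 2)⁻¹ := by
    simpa [div_eq_mul_inv] using (hlim.isBigO_one ℝ).mul (isBigO_inv_ofReal_sq_sub_sq k)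
  exact ((hcont.locallyIntegrable.locallyIntegrableOn (Ici a)).integrableOn_of_isBigO_atTop hO
    (integrable_inv_one_add_sq.integrableAtFilter _)).mono_set Ioi_subset_Ici_self

lemma intervalIntegral_neg_self_eq {f : ℝ → ℂ} (hf : Continuous f) (R : ℝ) :
    ∫ t in (-R)..R, f t = ∫ t in (0 : ℝ)..R, (f t + f (-t)) := by
  have hneg : Continuous fun t : ℝ => f (-t) := hf.comp continuous_neg
  rw [intervalIntegral.integral_add (hf.intervalIntegrable _ _) (hneg.intervalIntegrable _ _),
    intervalIntegral.integral_comp_neg, neg_zero, add_comm,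
    intervalIntegral.integral_add_adjacent_intervals (hf.intervalIntegrable _ _)
      (hf.intervalIntegrable _ _)]

/-- for even continuous `g` vanishing at infinity and `Im k > 0`,
`t ↦ g(t)/(t² - k²)` is integrable on `(0,∞)` and the symmetric limit
`lim_{R→∞} ∫_{-R}^{R} g(t)/(t - k) dt` exists and equals `2k ∫₀^∞ g(t)/(t² - k²) dt`. -/
theorem principal_value_upper_half_plane (g : ℝ → ℂ) (hg : Continuous g)
    (heven : ∀ t : ℝ, g (-t) = g t)
    (hlim : Tendsto g atTop (nhds 0)) :
    ∀ k : ℂ, 0 < k.im →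
      IntegrableOn (fun t : ℝ => g t / ((t : ℂ) ^ 2 - k ^ 2)) (Set.Ioi 0) ∧
      Tendsto (fun R : ℝ => ∫ t in (-R)..R, g t / ((t : ℂ) - k)) atTop
        (nhds (2 * k * ∫ t in Set.Ioi (0 : ℝ), g t / ((t : ℂ) ^ 2 - k ^ 2))) := by
  intro k hk
  have hint := integrableOn_Ioi_div_ofReal_sq_sub_sq hg hlim hk 0
  refine ⟨hint, ?_⟩
  refine ((intervalIntegral_tendsto_integral_Ioi 0 hint tendsto_id).const_mul (2 * k)).congr
    fun R => ?_
  have hcont : Continuous fun t : ℝ => g t / ((t : ℂ) - k) :=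
    hg.div (by fun_prop) (ofReal_sub_ne_zero_of_im_pos hk)
  rw [intervalIntegral_neg_self_eq hcont, ← intervalIntegral.integral_const_mul]
  refine intervalIntegral.integral_congr fun t _ => ?_
  have hsub := ofReal_sub_ne_zero_of_im_pos hk t
  have hadd := ofReal_add_ne_zero_of_im_pos hk t
  have hneg : ((-t : ℝ) : ℂ) - k = -((t : ℂ) + k) := by push_cast; ring
  simp only [heven, hneg, sq_sub_sq]
  field_simp
  ring
end
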